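/- arXiv:1709.00683 — 2 statements merged into one kernel-verified Lean document; each statement's English description precedes it below -/
import Mathlib

section
/- Special inverse function theorem: Let X be a normed linear space, K ⊆ X a convex cone, V a neighbourhood of a point ŵ ∈ K, and Ĝ : V → ℝ^m a mapping that is continuous and bounded on V and twice Fréchet differentiable at ŵ. Let q ∈ ker Ĝ'(ŵ) ∩ K with ‖q‖ = 1, and assume 0 ∈ int{ Ĝ'(ŵ)(K − ŵ) + conv Ĝ''(ŵ)[q,q] }. Then there exist a neighbourhood V₁ of Ĝ(ŵ) in ℝ^m and a constant κ > 0 such that for every y ∈ V₁ with y ≠ Ĝ(ŵ) there exists δ_y > 0 with the property: every continuous bounded mapping G : V → ℝ^m with sup_{w ∈ V} |G(w) − Ĝ(w)| < δ_y admits a point w_G(y) ∈ V ∩ K such that G(w_G(y)) = y and ‖w_G(y) − ŵ‖_X ≤ κ |y − Ĝ(ŵ)|^{1/2}; moreover for y = Ĝ(ŵ) the point w = ŵ satisfies Ĝ(w) = y with the same bound. -/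
open Set Topology Filter

open Polynomial in
lemma sift_poly {m : ℕ} (x g p : Fin m → ℝ) (A : (Fin m → ℝ) →L[ℝ] (Fin m → ℝ)) (c : ℝ) (N : ℕ) :
    ∃ P : ℝ[X], P.natDegree ≤ 2 * N + m ∧ ∀ t : ℝ, P.eval t =
      (1 - c * ∑ i, (x i + t * g i - p i) ^ 2) ^ N *
        (ContinuousLinearMap.id ℝ (Fin m → ℝ) + t • A).det := by
  classical
  let M : Matrix (Fin m) (Fin m) ℝ := LinearMap.toMatrix' (A : (Fin m → ℝ) →ₗ[ℝ] (Fin m → ℝ))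
  let Q : ℝ[X] := Matrix.det ((X : ℝ[X]) • M.map C + (1 : Matrix (Fin m) (Fin m) ℝ).map C)
  let S : ℝ[X] := 1 - C c * ∑ i, (C (x i) + X * C (g i) - C (p i)) ^ 2
  have hQ : Q.natDegree ≤ m := by
    have := natDegree_det_X_add_C_le M (1 : Matrix (Fin m) (Fin m) ℝ)
    rwa [Fintype.card_fin] at this
  have hS : S.natDegree ≤ 2 := by
    refine (natDegree_sub_le _ _).trans ?_
    simp only [natDegree_one, zero_le, sup_of_le_right]
    refine (natDegree_C_mul_le _ _).trans ?_
    refine natDegree_sum_le_of_forall_le _ _ fun i _ => ?_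
    compute_degree
  refine ⟨S ^ N * Q, ?_, fun t => ?_⟩
  · refine natDegree_mul_le.trans (add_le_add ?_ hQ)
    refine natDegree_pow_le.trans ?_
    rw [mul_comm]; gcongr
  · rw [eval_mul, eval_pow]
    congr 1
    · simp [S, eval_finsetSum, mul_comm t]
    · have h1 : Q.eval t = Matrix.det (1 + t • M) := by
        simp only [Q]
        rw [← coe_evalRingHom, RingHom.map_det]
        congr 1
        ext i j
        by_cases h : i = j <;> simp [h, add_comm, mul_comm t]
      rw [h1]
      show _ = LinearMap.det _
      rw [← LinearMap.det_toMatrix']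
      congr 1
      ext i j
      simp [M, LinearMap.toMatrix'_apply, Matrix.one_apply, Pi.single_apply]

open Polynomial in
lemma sift_interp (D : ℕ) (τ : ℝ) (hτ : 0 < τ) :
    ∃ (c s : ℕ → ℝ), (∀ j, 0 < s j ∧ s j ≤ τ) ∧ ∀ P : ℝ[X], P.natDegree ≤ D →
      P.eval 1 = ∑ j ∈ Finset.range (D + 1), c j * P.eval (s j) := by
  let s : ℕ → ℝ := fun j => τ / (j + 1)
  refine ⟨fun j => (Lagrange.basis (Finset.range (D + 1)) s j).eval 1, s, ?_, ?_⟩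
  · intro j
    have : (0:ℝ) < j + 1 := by positivity
    refine ⟨by positivity, ?_⟩
    apply div_le_self hτ.le
    linarith [(Nat.cast_nonneg j : (0:ℝ) ≤ j)]
  · intro P hP
    have hinj : Set.InjOn s (Finset.range (D + 1)) := by
      intro i _ j _ h
      simp only [s] at h
      have h1 : (0:ℝ) < i + 1 := by positivity
      have h2 : (0:ℝ) < j + 1 := by positivity
      field_simp at h
      have : (i:ℝ) = j := by linarith
      exact_mod_cast this
    have hd : P.degree < (Finset.range (D + 1)).card := by
      rw [Finset.card_range]
      refine lt_of_le_of_lt degree_le_natDegree ?_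
      exact_mod_cast Nat.lt_succ_of_le hP
    have := Lagrange.eq_interpolate hinj hd
    conv_lhs => rw [this]
    rw [Lagrange.interpolate_apply, eval_finsetSum]
    refine Finset.sum_congr rfl fun j _ => ?_
    rw [eval_mul, eval_C, mul_comm]

/-- small perturbations of the identity are good -/
lemma sift_small {m : ℕ} (g : (Fin m → ℝ) → (Fin m → ℝ)) (hg : ContDiff ℝ 1 g)
    (hs : HasCompactSupport g) : ∃ τ > (0:ℝ), ∀ t, 0 < t → t ≤ τ →
      (∀ x, 0 < (ContinuousLinearMap.id ℝ (Fin m → ℝ) + t • fderiv ℝ g x).det) ∧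
      Function.Bijective (fun x => x + t • g x) := by
  obtain ⟨C, hC⟩ := hg.lipschitzWith_of_hasCompactSupport hs one_ne_zero
  have hdet : ∀ᶠ A in 𝓝 (ContinuousLinearMap.id ℝ (Fin m → ℝ)), 0 < A.det := by
    have : Continuous fun A : (Fin m → ℝ) →L[ℝ] (Fin m → ℝ) => A.det :=
      ContinuousLinearMap.continuous_det
    refine this.continuousAt.eventually (lt_mem_nhds ?_)
    simp [ContinuousLinearMap.det]
  obtain ⟨ε, hε, hball⟩ := Metric.eventually_nhds_iff.1 hdet
  have hC0 : (0:ℝ) ≤ C := C.2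
  refine ⟨min (ε / (2 * (C + 1))) (1 / (2 * (C + 1))), by positivity, fun t ht htτ => ⟨fun x => ?_, ?_⟩⟩
  · apply hball
    rw [dist_eq_norm, add_sub_cancel_left, norm_smul, Real.norm_of_nonneg ht.le]
    have h1 : ‖fderiv ℝ g x‖ ≤ C := norm_fderiv_le_of_lipschitz ℝ hC
    have h2 := htτ.trans (min_le_left _ _)
    rw [le_div_iff₀ (by positivity)] at h2
    nlinarith
  · have hs2 := htτ.trans (min_le_right _ _)
    rw [le_div_iff₀ (by positivity)] at hs2
    have happ : ApproximatesLinearOn (fun x => x + t • g x)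
        ((ContinuousLinearEquiv.refl ℝ (Fin m → ℝ) : (Fin m → ℝ) ≃L[ℝ] (Fin m → ℝ)) :
          (Fin m → ℝ) →L[ℝ] (Fin m → ℝ)) univ (1/2) := by
      intro x _ y _
      have := hC.dist_le_mul x y
      rw [dist_eq_norm, dist_eq_norm] at this
      have e : x + t • g x - (y + t • g y) - (x - y) = t • (g x - g y) := by
        rw [smul_sub]; abel
      simp only [ContinuousLinearEquiv.coe_refl, ContinuousLinearMap.id_apply, e]
      rw [norm_smul, Real.norm_of_nonneg ht.le]
      have := norm_nonneg (x - y)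
      push_cast
      nlinarith
    have hc : Subsingleton (Fin m → ℝ) ∨ (1/2 : NNReal) <
        ‖(((ContinuousLinearEquiv.refl ℝ (Fin m → ℝ)).symm : (Fin m → ℝ) ≃L[ℝ] (Fin m → ℝ)) :
          (Fin m → ℝ) →L[ℝ] (Fin m → ℝ))‖₊⁻¹ := by
      rcases subsingleton_or_nontrivial (Fin m → ℝ) with h | h
      · exact Or.inl h
      · right
        have : ‖(((ContinuousLinearEquiv.refl ℝ (Fin m → ℝ)).symm : (Fin m → ℝ) ≃L[ℝ] (Fin m → ℝ)) :
          (Fin m → ℝ) →L[ℝ] (Fin m → ℝ))‖₊ = 1 := by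
          ext
          simp
        rw [this, inv_one]
        exact NNReal.half_lt_self one_ne_zero
    exact ⟨injOn_univ.1 (happ.injOn hc), happ.surjective hc⟩

open MeasureTheory in
lemma sift_integral {m : ℕ} (g : (Fin m → ℝ) → (Fin m → ℝ)) (hg : ContDiff ℝ 1 g)
    (hs : HasCompactSupport g) (R : ℝ) (hR : ∀ x, x ∉ Metric.closedBall 0 R → g x = 0)
    (p : Fin m → ℝ) (c : ℝ) (N : ℕ) :
    ∫ x in Metric.closedBall 0 R, (1 - c * ∑ i, (x i + g x i - p i) ^ 2) ^ N *
        (ContinuousLinearMap.id ℝ (Fin m → ℝ) + fderiv ℝ g x).det =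
    ∫ x in Metric.closedBall (0 : Fin m → ℝ) R, (1 - c * ∑ i, (x i - p i) ^ 2) ^ N := by
  obtain ⟨τ, hτ, hsm⟩ := sift_small g hg hs
  obtain ⟨a, s, hs', hP⟩ := sift_interp (2 * N + m) τ hτ
  set B := Metric.closedBall (0 : Fin m → ℝ) R with hB
  let J : ℝ → (Fin m → ℝ) → ℝ := fun t x =>
    (1 - c * ∑ i, (x i + t * g x i - p i) ^ 2) ^ N *
        (ContinuousLinearMap.id ℝ (Fin m → ℝ) + t • fderiv ℝ g x).det
  have hgc := hg.continuous
  have hgd : Continuous (fderiv ℝ g) := hg.continuous_fderiv one_ne_zero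
  have hJc : ∀ t, Continuous (J t) := by
    intro t
    refine Continuous.mul (by fun_prop) ?_
    exact ContinuousLinearMap.continuous_det.comp (by fun_prop)
  have hJ1 : ∀ x, J 1 x = ∑ j ∈ Finset.range (2 * N + m + 1), a j * J (s j) x := by
    intro x
    obtain ⟨P, hPd, hPe⟩ := sift_poly x (g x) p (fderiv ℝ g x) c N
    have := hP P hPd
    simp only [hPe] at this
    exact this
  have ha : ∑ j ∈ Finset.range (2 * N + m + 1), a j = 1 := by
    have := hP 1 (by simp)
    simpa using this.symm
  have hJs : ∀ t, 0 < t → t ≤ τ → ∫ x in B, J t x =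
      ∫ x in B, (1 - c * ∑ i, (x i - p i) ^ 2) ^ N := by
    intro t ht htτ
    obtain ⟨hd, hbij⟩ := hsm t ht htτ
    have him : (fun x => x + t • g x) '' B = B := by
      apply Subset.antisymm
      · rintro _ ⟨x, hx, rfl⟩
        by_contra hn
        have h0 := hR _ hn
        have : (x + t • g x) + t • g (x + t • g x) = x + t • g x := by rw [h0]; simp
        have h2 := hbij.1 this
        exact hn (by simpa only [h2] using hx)
      · intro y hy
        obtain ⟨x, hx⟩ := hbij.2 y
        refine ⟨x, ?_, hx⟩
        by_contra hn
        have h0 := hR _ hn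
        simp only [h0, smul_zero, add_zero] at hx
        exact hn (hx ▸ hy)
    have hcv := integral_image_eq_integral_abs_det_fderiv_smul (volume : Measure (Fin m → ℝ))
      (s := B) (f := fun x => x + t • g x)
      (f' := fun x => ContinuousLinearMap.id ℝ (Fin m → ℝ) + t • fderiv ℝ g x)
      Metric.isClosed_closedBall.measurableSet
      (fun x _ => by
        have h1 : HasFDerivAt g (fderiv ℝ g x) x :=
          (hg.differentiable one_ne_zero x).hasFDerivAt
        exact ((hasFDerivAt_id x).add (h1.const_smul t)).hasFDerivWithinAt)
      hbij.1.injOn (fun x => (1 - c * ∑ i, (x i - p i) ^ 2) ^ N)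
    rw [him] at hcv
    rw [hcv]
    congr 1
    ext x
    simp only [J, abs_of_pos (hd x), smul_eq_mul, Pi.add_apply, Pi.smul_apply]
    rw [mul_comm]
  have h1 : ∫ x in B, J 1 x = ∫ x in B, (1 - c * ∑ i, (x i - p i) ^ 2) ^ N := by
    simp only [hJ1]
    rw [integral_finsetSum]
    · simp only [integral_const_mul]
      rw [Finset.sum_congr rfl (fun j _ => by rw [hJs (s j) (hs' j).1 (hs' j).2])]
      rw [← Finset.sum_mul, ha, one_mul]
    · intro j _
      exact ((hJc (s j)).const_mul _ |>.continuousOn.integrableOn_compact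
        (isCompact_closedBall _ _))
  simpa [J] using h1

open MeasureTheory in
lemma sift_smooth_surj {m : ℕ} (g : (Fin m → ℝ) → (Fin m → ℝ)) (hg : ContDiff ℝ 1 g)
    (hs : HasCompactSupport g) (p : Fin m → ℝ) : ∃ x, x + g x = p := by
  by_contra! hne
  obtain ⟨R0, hR0⟩ := hs.isCompact.isBounded.subset_closedBall 0
  set R := max R0 (‖p‖ + 1) with hRdef
  have hR : ∀ x, x ∉ Metric.closedBall 0 R → g x = 0 := by
    intro x hx
    by_contra h
    have h1 : x ∈ tsupport g := subset_tsupport g h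
    exact hx (Metric.closedBall_subset_closedBall (le_max_left _ _) (hR0 h1))
  set B := Metric.closedBall (0 : Fin m → ℝ) R with hB
  have hBc : IsCompact B := isCompact_closedBall _ _
  have hgc := hg.continuous
  have hgd : Continuous (fderiv ℝ g) := hg.continuous_fderiv one_ne_zero
  let S : (Fin m → ℝ) → ℝ := fun x => ∑ i, (x i - p i) ^ 2
  have hSc : Continuous S := by fun_prop
  have hS0 : ∀ x, 0 ≤ S x := fun x => Finset.sum_nonneg fun i _ => sq_nonneg _
  let h : (Fin m → ℝ) → (Fin m → ℝ) := fun x => x + g x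
  have hhc : Continuous h := by fun_prop
  have hpB : p ∈ B := by
    simp only [hB, mem_closedBall_zero_iff, hRdef]
    exact le_trans (by linarith) (le_max_right _ _)
  have hSpos : ∀ x, 0 < S (h x) := by
    intro x
    refine lt_of_le_of_ne (hS0 _) fun h0 => hne x ?_
    have := (Finset.sum_eq_zero_iff_of_nonneg (fun i _ => sq_nonneg _)).1 h0.symm
    ext i
    have := this i (Finset.mem_univ _)
    have := pow_eq_zero_iff (two_ne_zero) |>.1 this
    simp only [h] at this
    linarith
  obtain ⟨x0, _, hx0⟩ := hBc.exists_isMinOn ⟨p, hpB⟩ (hSc.comp hhc).continuousOn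
  set η := S (h x0) with hη
  have hηpos : 0 < η := hSpos x0
  have hηle : ∀ x ∈ B, η ≤ S (h x) := fun x hx => hx0 hx
  obtain ⟨M1, hM1⟩ := hBc.exists_bound_of_continuousOn hSc.continuousOn
  obtain ⟨M2, hM2⟩ := hBc.exists_bound_of_continuousOn (hSc.comp hhc).continuousOn
  set M := max (max M1 M2) (η + 1) with hM
  have hMη : η < M := lt_of_lt_of_le (by linarith) (le_max_right _ _)
  have hMpos : 0 < M := hηpos.trans hMη
  have hMS : ∀ x ∈ B, S x ≤ M := fun x hx =>
    ((Real.le_norm_self _).trans (hM1 x hx)).trans ((le_max_left _ _).trans (le_max_left _ _))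
  have hMSh : ∀ x ∈ B, S (h x) ≤ M := fun x hx =>
    ((Real.le_norm_self _).trans (hM2 x hx)).trans ((le_max_right _ _).trans (le_max_left _ _))
  -- ball around p
  have hball : ∃ ε > 0, Metric.ball p ε ⊆ B ∧ ∀ x ∈ Metric.ball p ε, S x < η / 2 := by
    have h1 : ∀ᶠ x in 𝓝 p, S x < η / 2 := by
      refine hSc.continuousAt.eventually (gt_mem_nhds ?_)
      simp only [S, sub_self]
      simpa using hηpos
    have h2 : ∀ᶠ x in 𝓝 p, x ∈ B := by
      refine Filter.mem_of_superset (Metric.ball_mem_nhds p one_pos) fun x hx => ?_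
      simp only [hB, mem_closedBall_zero_iff, hRdef]
      rw [mem_ball_iff_norm] at hx
      have : ‖x‖ ≤ ‖x - p‖ + ‖p‖ := by simpa using norm_add_le (x - p) p
      exact le_trans (b := ‖p‖ + 1) (by linarith) (le_max_right _ _)
    obtain ⟨ε, hε, hh⟩ := Metric.eventually_nhds_iff_ball.1 (h1.and h2)
    exact ⟨ε, hε, fun x hx => (hh x hx).2, fun x hx => (hh x hx).1⟩
  obtain ⟨ε, hε, hεB, hεS⟩ := hball
  set v := (volume (Metric.ball p ε)).toReal with hv
  have hvpos : 0 < v := ENNReal.toReal_pos (Metric.measure_ball_pos volume p hε).ne'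
    measure_ball_lt_top.ne
  set a := 1 - M⁻¹ * η with ha
  set b := 1 - M⁻¹ * (η / 2) with hb
  have hMi : 0 < M⁻¹ := inv_pos.2 hMpos
  have hMM : M⁻¹ * M = 1 := inv_mul_cancel₀ hMpos.ne'
  have ha0 : 0 < a := by
    have : M⁻¹ * η < M⁻¹ * M := by gcongr
    linarith
  have hab : a < b := by nlinarith
  let dd : (Fin m → ℝ) → ℝ := fun x => (ContinuousLinearMap.id ℝ (Fin m → ℝ) + fderiv ℝ g x).det
  have hddc : Continuous dd := ContinuousLinearMap.continuous_det.comp (by fun_prop)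
  obtain ⟨Dm, hDm⟩ := hBc.exists_bound_of_continuousOn hddc.continuousOn
  set VB := (volume B).toReal with hVB
  have key : ∀ N : ℕ, b ^ N * v ≤ a ^ N * (Dm * VB) := by
    intro N
    have hI := sift_integral g hg hs R hR p M⁻¹ N
    have hlow : b ^ N * v ≤ ∫ x in B, (1 - M⁻¹ * S x) ^ N := by
      have hint : IntegrableOn (fun x => (1 - M⁻¹ * S x) ^ N) B :=
        ContinuousOn.integrableOn_compact hBc (by fun_prop)
      calc b ^ N * v = ∫ x in Metric.ball p ε, b ^ N := by
            rw [setIntegral_const, smul_eq_mul, mul_comm]; rfl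
        _ ≤ ∫ x in Metric.ball p ε, (1 - M⁻¹ * S x) ^ N := by
            refine setIntegral_mono_on (integrableOn_const measure_ball_lt_top.ne) (hint.mono_set hεB)
              measurableSet_ball fun x hx => ?_
            have := hεS x hx
            refine pow_le_pow_left₀ (ha0.trans hab).le ?_ _
            nlinarith
        _ ≤ ∫ x in B, (1 - M⁻¹ * S x) ^ N := by
            refine setIntegral_mono_set hint ?_ hεB.eventuallyLE
            refine (ae_restrict_iff' hBc.measurableSet).2 (Eventually.of_forall fun x hx => ?_)
            refine pow_nonneg ?_ _
            have := hMS x hx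
            nlinarith
    have hup : ∫ x in B, (1 - M⁻¹ * S (h x)) ^ N * dd x ≤ a ^ N * (Dm * VB) := by
      refine (Real.le_norm_self _).trans ?_
      rw [← mul_assoc]
      refine norm_setIntegral_le_of_norm_le_const hBc.measure_lt_top fun x hx => ?_
      rw [norm_mul, norm_pow]
      have h1 := hMSh x hx
      have h2 := hηle x hx
      have h3 : 0 ≤ 1 - M⁻¹ * S (h x) := by nlinarith
      rw [Real.norm_of_nonneg h3]
      have h4 : 1 - M⁻¹ * S (h x) ≤ a := by nlinarith
      exact mul_le_mul (pow_le_pow_left₀ h3 h4 _) (hDm x hx) (norm_nonneg _) (by positivity)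
    have hI' : ∫ x in B, (1 - M⁻¹ * S (h x)) ^ N * dd x = ∫ x in B, (1 - M⁻¹ * S x) ^ N := hI
    linarith
  have hb0 : 0 < b := ha0.trans hab
  have hDV : 0 < Dm * VB := by
    have := key 0
    simp only [pow_zero, one_mul] at this
    linarith
  obtain ⟨N, hN⟩ := exists_pow_lt_of_lt_one (div_pos hvpos hDV) ((div_lt_one hb0).2 hab)
  rw [div_pow, div_lt_div_iff₀ (by positivity) hDV] at hN
  linarith [key N]

lemma sift_bdd_surj {m : ℕ} (g : (Fin m → ℝ) → (Fin m → ℝ)) (hg : Continuous g)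
    (r : ℝ) (hr : ∀ x, ‖g x‖ ≤ r) (p : Fin m → ℝ) : ∃ x, x + g x = p := by
  set R := ‖p‖ + r + 1 with hR
  have hr0 : 0 ≤ r := (norm_nonneg _).trans (hr 0)
  have hR0 : 0 ≤ R := by positivity
  let χ : (Fin m → ℝ) → ℝ := fun x => max 0 (min 1 (R + 1 - ‖x‖))
  have hχc : Continuous χ := by fun_prop
  have hχ0 : ∀ x, 0 ≤ χ x := fun x => le_max_left _ _
  have hχ1 : ∀ x, χ x ≤ 1 := fun x => max_le zero_le_one (min_le_left _ _)
  have hχin : ∀ x, ‖x‖ ≤ R → χ x = 1 := by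
    intro x hx
    simp only [χ]
    rw [min_eq_left (by linarith), max_eq_right zero_le_one]
  have hχout : ∀ x, R + 1 < ‖x‖ → χ x = 0 := by
    intro x hx
    simp only [χ]
    rw [max_eq_left]
    exact (min_le_right _ _).trans (by linarith)
  let f : (Fin m → ℝ) → (Fin m → ℝ) := fun x => χ x • g x
  have hfc : Continuous f := hχc.smul hg
  have hfr : ∀ x, ‖f x‖ ≤ r := by
    intro x
    simp only [f, norm_smul, Real.norm_of_nonneg (hχ0 x)]
    nlinarith [hr x, hχ0 x, hχ1 x, norm_nonneg (g x)]
  have hfs : Function.support f ⊆ Metric.closedBall 0 (R + 1) := by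
    intro x hx
    by_contra h
    apply hx
    simp only [mem_closedBall_zero_iff, not_le] at h
    simp [f, hχout x h]
  have happ : ∀ ε, 0 < ε → ε ≤ 1 → ∃ x ∈ Metric.closedBall (0 : Fin m → ℝ) R, ‖x + f x - p‖ ≤ ε := by
    intro ε hε hε1
    obtain ⟨u, hu, hud, hus⟩ := hfc.exists_contDiff_approx (n := 1) (continuous_const (y := ε))
      (fun _ => hε)
    have hcs : HasCompactSupport u :=
      HasCompactSupport.of_support_subset_isCompact (isCompact_closedBall _ _) (hus.trans hfs)
    obtain ⟨x, hx⟩ := sift_smooth_surj u (by exact_mod_cast hu) hcs p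
    have hd := hud x
    rw [dist_eq_norm] at hd
    refine ⟨x, ?_, ?_⟩
    · rw [mem_closedBall_zero_iff]
      have e : x = p - (u x - f x) - f x := by rw [← hx]; abel
      calc ‖x‖ = ‖p - (u x - f x) - f x‖ := by rw [← e]
        _ ≤ ‖p - (u x - f x)‖ + ‖f x‖ := norm_sub_le _ _
        _ ≤ ‖p‖ + ‖u x - f x‖ + ‖f x‖ := by gcongr; exact norm_sub_le _ _
        _ ≤ R := by linarith [hfr x]
    · have e : x + f x - p = - (u x - f x) := by rw [← hx]; abel
      rw [e, norm_neg]; exact hd.le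
  obtain ⟨x0, hx0B, hx0⟩ := (isCompact_closedBall (0 : Fin m → ℝ) R).exists_isMinOn
    ⟨0, by simpa using hR0⟩ (f := fun x => ‖x + f x - p‖) (by fun_prop)
  have h0 : ‖x0 + f x0 - p‖ = 0 := by
    by_contra hne
    have hpos : 0 < ‖x0 + f x0 - p‖ := lt_of_le_of_ne (norm_nonneg _) (Ne.symm hne)
    obtain ⟨x, hxB, hx⟩ := happ (min 1 (‖x0 + f x0 - p‖ / 2)) (by positivity) (min_le_left _ _)
    have h1 : ‖x0 + f x0 - p‖ ≤ ‖x + f x - p‖ := hx0 hxB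
    have h2 := hx.trans (min_le_right _ _)
    linarith
  refine ⟨x0, ?_⟩
  have := sub_eq_zero.1 (norm_eq_zero.1 h0)
  simpa only [f, hχin x0 (by simpa using hx0B), one_smul] using this

lemma sift_cover {m : ℕ} (F : (Fin m → ℝ) → (Fin m → ℝ))
    (hF : ContinuousOn F (Metric.closedBall 0 2))
    (hF1 : ∀ z ∈ Metric.closedBall (0 : Fin m → ℝ) 2, ‖F z - z‖ ≤ 1)
    (p : Fin m → ℝ) (hp : ‖p‖ ≤ 1) : ∃ z ∈ Metric.closedBall (0 : Fin m → ℝ) 2, F z = p := by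
  let π : (Fin m → ℝ) → (Fin m → ℝ) := fun z i => max (-2) (min 2 (z i))
  have hπc : Continuous π := by fun_prop
  have hπB : ∀ z, π z ∈ Metric.closedBall (0 : Fin m → ℝ) 2 := by
    intro z
    rw [mem_closedBall_zero_iff, pi_norm_le_iff_of_nonneg (by norm_num)]
    intro i
    rw [Real.norm_eq_abs, abs_le]
    exact ⟨le_max_left _ _, max_le (by norm_num) (min_le_left _ _)⟩
  have hπid : ∀ z ∈ Metric.closedBall (0 : Fin m → ℝ) 2, π z = z := by
    intro z hz
    rw [mem_closedBall_zero_iff, pi_norm_le_iff_of_nonneg (by norm_num)] at hz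
    ext i
    have := abs_le.1 (hz i)
    simp only [π]
    rw [min_eq_right this.2, max_eq_right this.1]
  obtain ⟨z, hz⟩ := sift_bdd_surj (fun z => F (π z) - π z)
    ((hF.comp_continuous hπc hπB).sub hπc) 1 (fun z => hF1 _ (hπB z)) p
  have hzB : z ∈ Metric.closedBall (0 : Fin m → ℝ) 2 := by
    rw [mem_closedBall_zero_iff]
    have e : z = p - (F (π z) - π z) := by rw [← hz]; abel
    have h1 : ‖z‖ ≤ ‖p‖ + ‖F (π z) - π z‖ := by
      conv_lhs => rw [e]
      exact norm_sub_le _ _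
    linarith [hF1 _ (hπB z)]
  refine ⟨z, hzB, ?_⟩
  simp only [hπid z hzB] at hz
  rw [← hz]; abel

lemma sift_taylor {X : Type*} [NormedAddCommGroup X] [NormedSpace ℝ X] {m : ℕ} (w0 : X)
    (G0 : X → (Fin m → ℝ))
    (G' : X →L[ℝ] (Fin m → ℝ)) (G'' : X →L[ℝ] X →L[ℝ] (Fin m → ℝ))
    (hdiff : ∀ᶠ w in nhds w0, DifferentiableAt ℝ G0 w)
    (hG' : HasFDerivAt G0 G' w0)
    (hG'' : HasFDerivAt (fderiv ℝ G0) G'' w0) (ε : ℝ) (hε : 0 < ε) :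
    ∃ ρ > 0, ∀ h : X, ‖h‖ < ρ →
      ‖G0 (w0 + h) - G0 w0 - G' h - (1 / 2 : ℝ) • G'' h h‖ ≤ ε * ‖h‖ ^ 2 := by
  have h1 := hG''.isLittleO.def hε
  obtain ⟨ρ, hρ, hh⟩ := Metric.eventually_nhds_iff_ball.1 (h1.and hdiff)
  refine ⟨ρ, hρ, fun h hhρ => ?_⟩
  let φ : ℝ → (Fin m → ℝ) := fun t => G0 (w0 + t • h) - t • G' h - (t ^ 2 / 2) • G'' h h
  let φ' : ℝ → (Fin m → ℝ) := fun t => fderiv ℝ G0 (w0 + t • h) h - G' h - t • G'' h h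
  have hmem : ∀ t ∈ Icc (0:ℝ) 1, w0 + t • h ∈ Metric.ball w0 ρ := by
    intro t ht
    rw [mem_ball_iff_norm, add_sub_cancel_left, norm_smul, Real.norm_of_nonneg ht.1]
    nlinarith [ht.2, norm_nonneg h]
  have hd : ∀ t ∈ Icc (0:ℝ) 1, HasDerivWithinAt φ (φ' t) (Icc 0 1) t := by
    intro t ht
    apply HasDerivAt.hasDerivWithinAt
    have e1 : HasDerivAt (fun t : ℝ => w0 + t • h) h t := by
      simpa using ((hasDerivAt_id t).smul_const h).const_add w0
    have e2 : HasDerivAt (fun t : ℝ => G0 (w0 + t • h)) (fderiv ℝ G0 (w0 + t • h) h) t :=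
      (hh _ (hmem t ht)).2.hasFDerivAt.comp_hasDerivAt t e1
    have e3 : HasDerivAt (fun t : ℝ => t • G' h) (G' h) t := by
      simpa using (hasDerivAt_id t).smul_const (G' h)
    have e4 : HasDerivAt (fun t : ℝ => (t ^ 2 / 2) • G'' h h) (t • G'' h h) t := by
      have : HasDerivAt (fun t : ℝ => t ^ 2 / 2) t t := by
        have := ((hasDerivAt_id t).pow 2).div_const 2
        simpa using this
      exact this.smul_const _
    exact (e2.sub e3).sub e4
  have hb : ∀ t ∈ Ico (0:ℝ) 1, ‖φ' t‖ ≤ ε * ‖h‖ ^ 2 := by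
    intro t ht
    have ht' : t ∈ Icc (0:ℝ) 1 := ⟨ht.1, ht.2.le⟩
    have h2 := (hh _ (hmem t ht')).1
    rw [hG'.fderiv, add_sub_cancel_left] at h2
    have e : φ' t = (fderiv ℝ G0 (w0 + t • h) - G' - G'' (t • h)) h := by
      simp [φ']
    rw [e]
    refine (ContinuousLinearMap.le_opNorm _ _).trans ?_
    refine (mul_le_mul_of_nonneg_right h2 (norm_nonneg h)).trans ?_
    rw [norm_smul, Real.norm_of_nonneg ht.1]
    have : t * ‖h‖ ^ 2 ≤ 1 * ‖h‖ ^ 2 := by gcongr; exact ht.2.le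
    nlinarith
  have := norm_image_sub_le_of_norm_deriv_le_segment_01' hd hb
  have e : φ 1 - φ 0 = G0 (w0 + h) - G0 w0 - G' h - (1 / 2 : ℝ) • G'' h h := by
    simp only [φ, one_smul, zero_smul, add_zero]
    norm_num
    abel
  rwa [e] at this

lemma sift_select {X : Type*} [NormedAddCommGroup X] [NormedSpace ℝ X] {m : ℕ}
    (K : Set X)
    (hKconv : Convex ℝ K) (hKcone : ∀ c : ℝ, 0 ≤ c → ∀ x ∈ K, c • x ∈ K)
    (w0 : X) (hw0K : w0 ∈ K)
    (G' : X →L[ℝ] (Fin m → ℝ)) (Q : Fin m → ℝ)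
    (q : X) (hqK : q ∈ K)
    (hint : (0 : Fin m → ℝ) ∈ interior
      {z | ∃ w ∈ K, ∃ β : ℝ, 0 ≤ β ∧ z = G' (w - w0) + β • Q}) :
    ∃ (v : (Fin m → ℝ) → X) (b : (Fin m → ℝ) → ℝ), Continuous v ∧ Continuous b ∧
      (∀ z, 0 ≤ b z) ∧ (∀ z, G' (v z) + b z • Q = z) ∧
      ∃ T > 0, ∀ z ∈ Metric.closedBall (0 : Fin m → ℝ) 2, ∀ t c : ℝ, 0 ≤ t → t ≤ T → 0 ≤ c →
        w0 + (c • q + t • v z) ∈ K := by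
  obtain ⟨ρ, hρ, hball⟩ := Metric.mem_nhds_iff.1 (mem_interior_iff_mem_nhds.1 hint)
  have hpt : ∀ (i : Fin m) (σ : ℝ), |σ| = ρ / 2 → ∃ w ∈ K, ∃ β : ℝ, 0 ≤ β ∧
      Pi.single i σ = G' (w - w0) + β • Q := by
    intro i σ hσ
    apply hball
    rw [mem_ball_zero_iff, Pi.norm_single, Real.norm_eq_abs, hσ]
    linarith
  choose a haK α hα0 hα using fun i : Fin m => hpt i (ρ / 2) (abs_of_pos (by positivity))
  choose a' haK' α' hα0' hα' using fun i : Fin m => hpt i (-(ρ / 2))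
    (by rw [abs_neg]; exact abs_of_pos (by positivity))
  let A : (Fin m → ℝ) → Fin m → ℝ := fun z i => max (z i) 0 * (2 / ρ)
  let A' : (Fin m → ℝ) → Fin m → ℝ := fun z i => max (-z i) 0 * (2 / ρ)
  have hA0 : ∀ z i, 0 ≤ A z i := fun z i => by positivity
  have hA0' : ∀ z i, 0 ≤ A' z i := fun z i => by positivity
  refine ⟨fun z => ∑ i, (A z i • (a i - w0) + A' z i • (a' i - w0)),
    fun z => ∑ i, (A z i * α i + A' z i * α' i), by fun_prop, by fun_prop, ?_, ?_, ?_⟩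
  · intro z
    exact Finset.sum_nonneg fun i _ =>
      add_nonneg (mul_nonneg (hA0 z i) (hα0 i)) (mul_nonneg (hA0' z i) (hα0' i))
  · intro z
    have e : ∀ i, A z i • (G' (a i - w0) + α i • Q) + A' z i • (G' (a' i - w0) + α' i • Q)
        = Pi.single i (z i) := by
      intro i
      rw [← hα, ← hα', ← Pi.single_smul, ← Pi.single_smul, ← Pi.single_add]
      congr 1
      simp only [A, A', smul_eq_mul]
      have : max (z i) 0 - max (-z i) 0 = z i := by
        rcases le_total 0 (z i) with h | h
        · rw [max_eq_left h, max_eq_right (by linarith)]; ring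
        · rw [max_eq_right h, max_eq_left (by linarith)]; ring
      field_simp
      linarith
    calc _ = ∑ i, (A z i • (G' (a i - w0) + α i • Q) + A' z i • (G' (a' i - w0) + α' i • Q)) := by
          rw [map_sum, Finset.sum_smul, ← Finset.sum_add_distrib]
          refine Finset.sum_congr rfl fun i _ => ?_
          rw [map_add, map_smul, map_smul]
          module
      _ = z := by
          simp only [e]
          exact Finset.univ_sum_single z
  · let S : AddSubmonoid X :=
      { carrier := K
        zero_mem' := by simpa using hKcone 0 le_rfl w0 hw0K
        add_mem' := by
          intro x y hx hy
          have := hKcone 2 (by norm_num) _ (hKconv hx hy (a := 1/2) (b := 1/2) (by norm_num)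
            (by norm_num) (by norm_num))
          have e : (2:ℝ) • ((1/2 : ℝ) • x + (1/2 : ℝ) • y) = x + y := by module
          rwa [e] at this }
    let B : ℝ := ∑ i : Fin m, (2 * (2 / ρ) + 2 * (2 / ρ))
    have hB0 : 0 ≤ B := Finset.sum_nonneg fun i _ => by positivity
    refine ⟨1 / (B + 1), by positivity, fun z hz t c ht htT hc => ?_⟩
    have hsum : ∑ i, (A z i + A' z i) ≤ B := by
      refine Finset.sum_le_sum fun i _ => ?_
      rw [mem_closedBall_zero_iff, pi_norm_le_iff_of_nonneg (by norm_num)] at hz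
      have := abs_le.1 (hz i)
      simp only [A, A']
      gcongr
      · exact max_le this.2 (by norm_num)
      · exact max_le (by linarith [this.1]) (by norm_num)
    rw [le_div_iff₀ (by positivity)] at htT
    have e : w0 + (c • q + t • ∑ i, (A z i • (a i - w0) + A' z i • (a' i - w0))) =
        (1 - t * ∑ i, (A z i + A' z i)) • w0 + (c • q +
          ∑ i, ((t * A z i) • a i + (t * A' z i) • a' i)) := by
      have e1 : t • ∑ i, (A z i • (a i - w0) + A' z i • (a' i - w0)) =
          ∑ i, ((t * A z i) • a i + (t * A' z i) • a' i) - (t * ∑ i, (A z i + A' z i)) • w0 := by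
        rw [Finset.mul_sum, Finset.sum_smul, Finset.smul_sum, ← Finset.sum_sub_distrib]
        refine Finset.sum_congr rfl fun i _ => ?_
        module
      rw [e1]
      module
    show _ ∈ S
    rw [e]
    refine S.add_mem (hKcone _ ?_ _ hw0K) (S.add_mem (hKcone _ hc _ hqK)
      (S.sum_mem fun i _ => S.add_mem (hKcone _ (mul_nonneg ht (hA0 z i)) _ (haK i))
        (hKcone _ (mul_nonneg ht (hA0' z i)) _ (haK' i))))
    nlinarith



/-- **Special inverse function theorem.**
Let `X` be a normed linear space, `K ⊆ X` a convex cone, `V` a neighbourhood of a point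
`w0 ∈ K`, and `G0 : V → ℝ^m` continuous and bounded on `V` and twice Fréchet differentiable
at `w0` (with first derivative `G'` and second derivative `G''`).  Let `q ∈ ker G' ∩ K`,
`‖q‖ = 1`, and assume `0 ∈ int { G'(K − w0) + conv G''[q,q] }`.  Then there are a
neighbourhood `V₁` of `G0 w0` and `κ > 0` such that every `y ∈ V₁` with `y ≠ G0 w0` admits
`δ > 0` with: every continuous bounded `G : V → ℝ^m` that is uniformly `δ`-close to `G0`
on `V` has a point `w ∈ V ∩ K` with `G w = y` and `‖w − w0‖ ≤ κ |y − G0 w0|^{1/2}`;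
moreover for `y = G0 w0` the point `w0` itself works with the same bound. -/
theorem special_inverse_function_theorem
    {X : Type*} [NormedAddCommGroup X] [NormedSpace ℝ X] {m : ℕ}
    (K V : Set X)
    (hKconv : Convex ℝ K) (hKcone : ∀ c : ℝ, 0 ≤ c → ∀ x ∈ K, c • x ∈ K)
    (w0 : X) (hw0K : w0 ∈ K) (hV : V ∈ nhds w0)
    (G0 : X → (Fin m → ℝ))
    (hG0c : ContinuousOn G0 V) (hG0b : ∃ C, ∀ w ∈ V, ‖G0 w‖ ≤ C)
    (G' : X →L[ℝ] (Fin m → ℝ)) (G'' : X →L[ℝ] X →L[ℝ] (Fin m → ℝ))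
    (hdiff : ∀ᶠ w in nhds w0, DifferentiableAt ℝ G0 w)
    (hG' : HasFDerivAt G0 G' w0)
    (hG'' : HasFDerivAt (fderiv ℝ G0) G'' w0)
    (q : X) (hqker : G' q = 0) (hqK : q ∈ K) (hqnorm : ‖q‖ = 1)
    (hint : (0 : Fin m → ℝ) ∈ interior
      {z | ∃ w ∈ K, ∃ β : ℝ, 0 ≤ β ∧ z = G' (w - w0) + β • (G'' q q)}) :
    ∃ V₁ ∈ nhds (G0 w0), ∃ κ > (0:ℝ),
      (∀ y ∈ V₁, y ≠ G0 w0 → ∃ δ > (0:ℝ),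
        ∀ G : X → (Fin m → ℝ), ContinuousOn G V → (∃ C, ∀ w ∈ V, ‖G w‖ ≤ C) →
          (∀ w ∈ V, ‖G w - G0 w‖ < δ) →
          ∃ w ∈ V ∩ K, G w = y ∧ ‖w - w0‖ ≤ κ * Real.sqrt ‖y - G0 w0‖) ∧
      (G0 w0 = G0 w0 ∧ ‖w0 - w0‖ ≤ κ * Real.sqrt ‖G0 w0 - G0 w0‖) := by
  
  obtain ⟨v, b, hvc, hbc, hb0, hvb, T, hT, hK⟩ := sift_select K hKconv hKcone w0 hw0K G' (G'' q q)
    q hqK hint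
  have hcomp := isCompact_closedBall (0 : Fin m → ℝ) 2
  obtain ⟨Cv, hCv⟩ := hcomp.exists_bound_of_continuousOn hvc.continuousOn
  let d : (Fin m → ℝ) → ℝ := fun z => Real.sqrt (2 * b z)
  have hdc : Continuous d := by fun_prop
  have hd0 : ∀ z, 0 ≤ d z := fun z => Real.sqrt_nonneg _
  have hd2 : ∀ z, d z ^ 2 = 2 * b z := fun z => Real.sq_sqrt (by linarith [hb0 z])
  obtain ⟨Cd, hCd⟩ := hcomp.exists_bound_of_continuousOn hdc.continuousOn
  have h0B : (0 : Fin m → ℝ) ∈ Metric.closedBall (0 : Fin m → ℝ) 2 := by simp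
  have hCv0 : 0 ≤ Cv := (norm_nonneg _).trans (hCv 0 h0B)
  have hCd0 : 0 ≤ Cd := (norm_nonneg _).trans (hCd 0 h0B)
  set κ := Cd + Cv + 1 with hκ
  have hκ0 : 0 < κ := by positivity
  let H : ℝ → (Fin m → ℝ) → X := fun s z => (s * d z) • q + s ^ 2 • v z
  have hHn : ∀ s, 0 ≤ s → s ≤ 1 → ∀ z ∈ Metric.closedBall (0 : Fin m → ℝ) 2,
      ‖H s z‖ ≤ κ * s := by
    intro s hs hs1 z hz
    have h1 := hCd z hz
    have h2 := hCv z hz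
    rw [Real.norm_of_nonneg (hd0 z)] at h1
    calc ‖H s z‖ ≤ ‖(s * d z) • q‖ + ‖s ^ 2 • v z‖ := norm_add_le _ _
      _ = s * d z + s ^ 2 * ‖v z‖ := by
          rw [norm_smul, norm_smul, hqnorm, Real.norm_of_nonneg (mul_nonneg hs (hd0 z)),
            Real.norm_of_nonneg (sq_nonneg s), mul_one]
      _ ≤ s * Cd + s * Cv := by
          gcongr
          nlinarith
      _ ≤ κ * s := by nlinarith
  set ε := 1 / (4 * κ ^ 2) with hε
  obtain ⟨ρ, hρ, htay⟩ := sift_taylor w0 G0 G' G'' hdiff hG' hG'' ε (by positivity)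
  obtain ⟨ρV, hρV, hVball⟩ := Metric.mem_nhds_iff.1 hV
  set C3 := Cd * Cv * ‖G''‖ + Cv ^ 2 * ‖G''‖ with hC3
  have hC30 : 0 ≤ C3 := by positivity
  have hquad : ∀ s, 0 ≤ s → s ≤ 1 → ∀ z ∈ Metric.closedBall (0 : Fin m → ℝ) 2,
      ‖G' (H s z) + (1 / 2 : ℝ) • G'' (H s z) (H s z) - s ^ 2 • z‖ ≤ C3 * s ^ 3 := by
    intro s hs hs1 z hz
    have h1 := hCd z hz
    have h2 := hCv z hz
    rw [Real.norm_of_nonneg (hd0 z)] at h1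
    have e : G' (H s z) + (1 / 2 : ℝ) • G'' (H s z) (H s z) - s ^ 2 • z =
        (s ^ 3 * d z / 2) • (G'' q (v z) + G'' (v z) q) + (s ^ 4 / 2) • G'' (v z) (v z) := by
      have hbd : b z = d z ^ 2 / 2 := by rw [hd2]; ring
      have hGv : G' (v z) = z - (d z ^ 2 / 2) • G'' q q := by
        rw [← hbd]; exact eq_sub_of_add_eq (hvb z)
      simp only [H, map_add, map_smul, hqker, add_apply, smul_apply, hGv]
      module
    have n1 : ‖G'' q (v z)‖ ≤ ‖G''‖ * Cv := by
      refine (G''.le_opNorm₂ _ _).trans ?_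
      rw [hqnorm, mul_one]; gcongr
    have n2 : ‖G'' (v z) q‖ ≤ ‖G''‖ * Cv := by
      refine (G''.le_opNorm₂ _ _).trans ?_
      rw [hqnorm, mul_one]; gcongr
    have n3 : ‖G'' (v z) (v z)‖ ≤ ‖G''‖ * Cv * Cv := by
      refine (G''.le_opNorm₂ _ _).trans ?_
      gcongr
    rw [e]
    calc _ ≤ ‖(s ^ 3 * d z / 2) • (G'' q (v z) + G'' (v z) q)‖ +
          ‖(s ^ 4 / 2) • G'' (v z) (v z)‖ := norm_add_le _ _
      _ = (s ^ 3 * d z / 2) * ‖G'' q (v z) + G'' (v z) q‖ + (s ^ 4 / 2) * ‖G'' (v z) (v z)‖ := by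
          have := hd0 z
          rw [norm_smul, norm_smul, Real.norm_of_nonneg (by positivity),
            Real.norm_of_nonneg (by positivity)]
      _ ≤ (s ^ 3 * Cd / 2) * (‖G''‖ * Cv + ‖G''‖ * Cv) + (s ^ 3 / 2) * (‖G''‖ * Cv * Cv) := by
          have := hd0 z
          have h43 : s ^ 4 ≤ s ^ 3 := pow_le_pow_of_le_one hs hs1 (by norm_num)
          have n12 := (norm_add_le (G'' q (v z)) (G'' (v z) q)).trans (add_le_add n1 n2)
          refine add_le_add (mul_le_mul (by gcongr) n12 (norm_nonneg _) (by positivity))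
            (mul_le_mul (by linarith) n3 (norm_nonneg _) (by positivity))
      _ ≤ C3 * s ^ 3 := by
          have : 0 ≤ s ^ 3 * (‖G''‖ * Cv * Cv) := by positivity
          rw [hC3]; nlinarith
  -- threshold for s
  obtain ⟨s0, hs0, hs01, hs0T, hs0ρ, hs0V, hs0C⟩ : ∃ s0 > 0, s0 ≤ 1 ∧ s0 ≤ T ∧ κ * s0 ≤ ρ ∧
      κ * s0 ≤ ρV ∧ C3 * s0 ≤ 1 / 4 := by
    refine ⟨min (min 1 T) (min (min (ρ / κ) (ρV / κ)) (1 / (4 * (C3 + 1)))), by positivity,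
      ?_, ?_, ?_, ?_, ?_⟩
    · exact (min_le_left _ _).trans (min_le_left _ _)
    · exact (min_le_left _ _).trans (min_le_right _ _)
    · rw [← le_div_iff₀' hκ0]
      exact (min_le_right _ _).trans ((min_le_left _ _).trans (min_le_left _ _))
    · rw [← le_div_iff₀' hκ0]
      exact (min_le_right _ _).trans ((min_le_left _ _).trans (min_le_right _ _))
    · set u := min (min 1 T) (min (min (ρ / κ) (ρV / κ)) (1 / (4 * (C3 + 1)))) with hu
      have h1 : u ≤ 1 / (4 * (C3 + 1)) := (min_le_right _ _).trans (min_le_right _ _)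
      have h2 : 0 < u := by positivity
      rw [le_div_iff₀ (by positivity)] at h1
      nlinarith
  refine ⟨Metric.ball (G0 w0) (s0 ^ 2), Metric.ball_mem_nhds _ (by positivity), κ, hκ0, ?_,
    rfl, by simp⟩
  intro y hy hyne
  have hn0 : 0 < ‖y - G0 w0‖ := norm_pos_iff.2 (sub_ne_zero.2 hyne)
  set s := Real.sqrt ‖y - G0 w0‖ with hs
  have hspos : 0 < s := Real.sqrt_pos.2 hn0
  have hs2 : s ^ 2 = ‖y - G0 w0‖ := Real.sq_sqrt hn0.le
  have hss0 : s < s0 := by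
    rw [mem_ball_iff_norm, ← hs2] at hy
    exact lt_of_pow_lt_pow_left₀ 2 hs0.le hy
  have hs1 : s ≤ 1 := hss0.le.trans hs01
  refine ⟨s ^ 2 / 2, by positivity, fun G hGc _ hGδ => ?_⟩
  have hκs : κ * s < κ * s0 := by gcongr
  have hmemV : ∀ z ∈ Metric.closedBall (0 : Fin m → ℝ) 2, w0 + H s z ∈ V := by
    intro z hz
    apply hVball
    rw [mem_ball_iff_norm, add_sub_cancel_left]
    linarith [hHn s hspos.le hs1 z hz]
  have hHc : Continuous (H s) := by fun_prop
  obtain ⟨z, hz, hFz⟩ := sift_cover (fun z => (s ^ 2)⁻¹ • (G (w0 + H s z) - G0 w0)) (by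
      have hc1 : ContinuousOn (fun z => G (w0 + H s z)) (Metric.closedBall 0 2) :=
        hGc.comp (by fun_prop) hmemV
      have hc2 := hc1.sub (continuousOn_const (c := G0 w0))
      exact hc2.const_smul ((s ^ 2)⁻¹)) (by
      intro z hz
      have hH := hHn s hspos.le hs1 z hz
      have t1 := htay (H s z) (by linarith)
      have t2 := hquad s hspos.le hs1 z hz
      have t3 := hGδ _ (hmemV z hz)
      have e : (s ^ 2)⁻¹ • (G (w0 + H s z) - G0 w0) - z = (s ^ 2)⁻¹ •
          ((G (w0 + H s z) - G0 (w0 + H s z)) +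
           (G0 (w0 + H s z) - G0 w0 - G' (H s z) - (1 / 2 : ℝ) • G'' (H s z) (H s z)) +
           (G' (H s z) + (1 / 2 : ℝ) • G'' (H s z) (H s z) - s ^ 2 • z)) := by
        have : z = (s ^ 2)⁻¹ • (s ^ 2 • z) := by
          rw [smul_smul, inv_mul_cancel₀ (by positivity), one_smul]
        conv_lhs => rw [this]
        rw [← smul_sub]
        congr 1
        rw [← this]
        abel
      have t1' : ε * ‖H s z‖ ^ 2 ≤ s ^ 2 / 4 := by
        calc ε * ‖H s z‖ ^ 2 ≤ ε * (κ * s) ^ 2 := by gcongr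
          _ = s ^ 2 / 4 := by rw [hε]; field_simp
      have t2' : C3 * s ^ 3 ≤ s ^ 2 / 4 := by
        have : C3 * s ≤ 1 / 4 := le_trans (by gcongr) hs0C
        nlinarith [sq_nonneg s]
      have hsum := norm_add₃_le (a := G (w0 + H s z) - G0 (w0 + H s z))
        (b := G0 (w0 + H s z) - G0 w0 - G' (H s z) - (1 / 2 : ℝ) • G'' (H s z) (H s z))
        (c := G' (H s z) + (1 / 2 : ℝ) • G'' (H s z) (H s z) - s ^ 2 • z)
      simp only [e]
      rw [norm_smul, Real.norm_of_nonneg (by positivity), inv_mul_le_iff₀ (by positivity)]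
      linarith)
    ((s ^ 2)⁻¹ • (y - G0 w0)) (by
      rw [norm_smul, Real.norm_of_nonneg (by positivity), ← hs2,
        inv_mul_cancel₀ (by positivity)])
  refine ⟨w0 + H s z, ⟨hmemV z hz, ?_⟩, ?_, ?_⟩
  · exact hK z hz (s ^ 2) (s * d z) (sq_nonneg s) (by nlinarith) (mul_nonneg hspos.le (hd0 z))
  · have := smul_right_injective (Fin m → ℝ) (inv_ne_zero (pow_ne_zero 2 hspos.ne')) hFz
    exact sub_left_injective this
  · rw [add_sub_cancel_left]
    exact hHn s hspos.le hs1 z hz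
end

section
/- Proposition 1: Suppose (ξ̂,x̂,û) is an admissible point for system (1), the Basic Assumptions hold, and there exists q = (ζ,h,v) ∈ K(ξ̂,x̂,û) such that Λ(ξ̂,x̂,û,q) = ∅. For a tuple ū = (u₁,…,u_k) ∈ 𝒰^k define ℱ(ξ,x,ᾱ,u;ū) = F(ξ,x,u) + Σ_{i=1}^k αᵢ(F(ξ,x,uᵢ) − F(ξ,x,u)); by the implicit function theorem there is a twice continuously differentiable map (ξ,ᾱ,u) ↦ x(ξ,ᾱ,u;ū) on a neighbourhood of (ξ̂,0,û) with x(ξ̂,0,û;ū) = x̂ and ℱ(ξ,x(ξ,ᾱ,u;ū),ᾱ,u;ū) = 0; set Φ(ξ,ᾱ,r,u;ū) = (f(ξ,x(ξ,ᾱ,u;ū)) + r, g(ξ,x(ξ,ᾱ,u;ū)))ᵀ ∈ ℝ^{m₁+m₂}, and write w = (ξ,u). Then there exist k ∈ ℕ and a tuple ū̂ = (û₁,…,û_k) ∈ 𝒰^k such that 0 ∈ int{ Φ_{(ξ,ᾱ,r)}(ξ̂,0,0,û;ū̂)(ℝ^n × ℝ^k_+ × (ℝ^{m₁}_+ + f(ξ̂,x̂)))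 + conv Φ_{ww}(ξ̂,0,0,û;ū̂)[(ζ,v),(ζ,v)] }, where conv a = {βa : β ≥ 0}. -/
open Set Topology Filter Matrix

/-- The continuous linear embedding `x ↦ (0, x, 0)` of `X` into `ℝⁿ × X × Z`,
used to form the partial derivative of `F` with respect to `x`. -/
noncomputable def embX (n : ℕ) (X Z : Type*) [NormedAddCommGroup X] [NormedSpace ℝ X]
    [NormedAddCommGroup Z] [NormedSpace ℝ Z] :
    X →L[ℝ] ((Fin n → ℝ) × X × Z) :=
  (0 : X →L[ℝ] (Fin n → ℝ)).prod ((ContinuousLinearMap.id ℝ X).prod (0 : X →L[ℝ] Z))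


lemma second_deriv_curve {E G : Type*} [NormedAddCommGroup E] [NormedSpace ℝ E]
    [NormedAddCommGroup G] [NormedSpace ℝ G] (H : E → G) (γ : ℝ → E) (a : E) (h0 : γ 0 = a)
    (hH : ContDiffAt ℝ 2 H a) (hγ : ContDiffAt ℝ 2 γ 0) :
    deriv (fun t => H (γ t)) 0 = fderiv ℝ H a (deriv γ 0) ∧
    deriv (deriv (fun t => H (γ t))) 0 =
      fderiv ℝ (fderiv ℝ H) a (deriv γ 0) (deriv γ 0) + fderiv ℝ H a (deriv (deriv γ) 0) := by
  subst h0
  have e1 : ∀ᶠ t in 𝓝 (0:ℝ), deriv (fun t => H (γ t)) t = fderiv ℝ H (γ t) (deriv γ t) := by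
    have h1 := hγ.eventually (by simp)
    have h2 := hγ.continuousAt.eventually (hH.eventually (by simp))
    filter_upwards [h1, h2] with t h1 h2
    have := (h2.differentiableAt (by simp)).hasFDerivAt.comp_hasDerivAt t
      (h1.differentiableAt (by simp)).hasDerivAt
    exact this.deriv
  refine ⟨e1.self_of_nhds, ?_⟩
  rw [EventuallyEq.deriv_eq e1]
  have hH1 : DifferentiableAt ℝ (fderiv ℝ H) (γ 0) :=
    (hH.fderiv_right (m := 1) (by norm_num)).differentiableAt (by simp)
  have hγ1 : DifferentiableAt ℝ (deriv γ) 0 :=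
    ((hγ.fderiv_right (m := 1) (by norm_num)).differentiableAt (by simp)).clm_apply
      (differentiableAt_const (1:ℝ))
  have hA := hH1.hasFDerivAt.comp_hasDerivAt (0:ℝ) (hγ.differentiableAt (by simp)).hasDerivAt
  have := hA.clm_apply hγ1.hasDerivAt
  exact this.deriv

lemma deriv_prod2 {E G : Type*} [NormedAddCommGroup E] [NormedSpace ℝ E]
    [NormedAddCommGroup G] [NormedSpace ℝ G] (a : ℝ → E) (b : ℝ → G)
    (ha : ContDiffAt ℝ 2 a 0) (hb : ContDiffAt ℝ 2 b 0) :
    deriv (fun t => (a t, b t)) 0 = (deriv a 0, deriv b 0) ∧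
    deriv (deriv (fun t => (a t, b t))) 0 = (deriv (deriv a) 0, deriv (deriv b) 0) := by
  have e1 : ∀ᶠ t in 𝓝 (0:ℝ), deriv (fun t => (a t, b t)) t = (deriv a t, deriv b t) := by
    filter_upwards [ha.eventually (by simp), hb.eventually (by simp)] with t h1 h2
    exact ((h1.differentiableAt (by simp)).hasDerivAt.prodMk
      (h2.differentiableAt (by simp)).hasDerivAt).deriv
  refine ⟨e1.self_of_nhds, ?_⟩
  rw [EventuallyEq.deriv_eq e1]
  have ha1 : DifferentiableAt ℝ (deriv a) 0 :=
    ((ha.fderiv_right (m := 1) (by norm_num)).differentiableAt (by simp)).clm_apply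
      (differentiableAt_const (1:ℝ))
  have hb1 : DifferentiableAt ℝ (deriv b) 0 :=
    ((hb.fderiv_right (m := 1) (by norm_num)).differentiableAt (by simp)).clm_apply
      (differentiableAt_const (1:ℝ))
  exact (ha1.hasDerivAt.prodMk hb1.hasDerivAt).deriv

lemma deriv_line {E : Type*} [NormedAddCommGroup E] [NormedSpace ℝ E] (a v : E) :
    deriv (fun t : ℝ => a + t • v) = fun _ => v := by
  funext t
  simpa using (((hasDerivAt_id t).smul_const v).const_add a).deriv

/-- separation in finite dimension -/
lemma sep_zero {W : Type*} [NormedAddCommGroup W] [NormedSpace ℝ W] [FiniteDimensional ℝ W]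
    (C : Set W) (hC : Convex ℝ C) (h0 : (0:W) ∉ interior C) (hne : C.Nonempty) :
    ∃ L : W →ₗ[ℝ] ℝ, L ≠ 0 ∧ ∀ z ∈ C, 0 ≤ L z := by
  by_cases hi : (interior C).Nonempty
  · obtain ⟨L, hL⟩ := geometric_hahn_banach_open_point hC.interior isOpen_interior h0
    refine ⟨-(L : W →ₗ[ℝ] ℝ), ?_, ?_⟩
    · intro h
      obtain ⟨z, hz⟩ := hi
      have := hL z hz
      have h2 := LinearMap.congr_fun h z
      simp at h2 this
      linarith
    · intro z hz
      have hz' : z ∈ closure (interior C) := by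
        rw [hC.closure_interior_eq_closure_of_nonempty_interior hi]; exact subset_closure hz
      have : L z ≤ 0 := by
        have : closure (interior C) ⊆ {z | L z ≤ 0} :=
          closure_minimal (fun x hx => by simpa using (hL x hx).le)
            (isClosed_le L.continuous continuous_const)
        exact this hz'
      simpa using this
  · have h1 : affineSpan ℝ C ≠ ⊤ := fun h => hi (hC.interior_nonempty_iff_affineSpan_eq_top.2 h)
    obtain ⟨z0, hz0⟩ := hne
    have h2 : (affineSpan ℝ C).direction ≠ ⊤ := by
      intro h
      exact h1 ((AffineSubspace.direction_eq_top_iff_of_nonempty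
        ⟨z0, subset_affineSpan ℝ C hz0⟩).1 h)
    obtain ⟨L, hL0, hL⟩ := Submodule.exists_le_ker_of_lt_top _ (lt_top_iff_ne_top.2 h2)
    have hc : ∀ z ∈ C, L z = L z0 := by
      intro z hz
      have := hL (AffineSubspace.vsub_mem_direction (subset_affineSpan ℝ C hz)
        (subset_affineSpan ℝ C hz0))
      simp at this
      linarith
    rcases le_total 0 (L z0) with h | h
    · exact ⟨L, hL0, fun z hz => by rw [hc z hz]; exact h⟩
    · exact ⟨-L, by simpa using hL0, fun z hz => by simp [hc z hz, h]⟩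

lemma core_sep {W Y Z P : Type*} [NormedAddCommGroup W] [NormedSpace ℝ W] [FiniteDimensional ℝ W]
    [AddCommGroup Y] [Module ℝ Y] [AddCommGroup P] [Module ℝ P]
    (φ : Z → Y) (G : Set Z) (S : Set P) (hS : Convex ℝ S) (hSne : S.Nonempty)
    (w0 : W) (A : P →ₗ[ℝ] W) (B : Y →ₗ[ℝ] W) :
    (∃ (k : ℕ) (ub : Fin k → Z), (∀ i, ub i ∈ G) ∧
      (0:W) ∈ interior {z | ∃ p ∈ S, ∃ aa : Fin k → ℝ, (∀ i, 0 ≤ aa i) ∧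
        z = w0 + A p + B (∑ i, aa i • φ (ub i))}) ∨
    (∃ L : W →ₗ[ℝ] ℝ, L ≠ 0 ∧ ∀ p ∈ S, ∀ y ∈ Submodule.span NNReal (φ '' G),
      0 ≤ L (w0 + A p + B y)) := by
  classical
  have hconv : ∀ K : Submodule NNReal Y,
      Convex ℝ {z | ∃ p ∈ S, ∃ y ∈ K, z = w0 + A p + B y} := by
    rintro K z ⟨p, hp, y, hy, rfl⟩ z' ⟨p', hp', y', hy', rfl⟩ a b ha hb hab
    refine ⟨a • p + b • p', hS hp hp' ha hb hab, a • y + b • y', ?_, ?_⟩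
    · exact K.add_mem (K.smul_mem ⟨a, ha⟩ hy) (K.smul_mem ⟨b, hb⟩ hy')
    · have : w0 = a • w0 + b • w0 := by rw [← add_smul, hab, one_smul]
      conv_rhs => rw [this]
      simp only [map_add, map_smul, smul_add]
      abel
  by_cases h0 : (0:W) ∈ interior {z | ∃ p ∈ S, ∃ y ∈ Submodule.span NNReal (φ '' G),
      z = w0 + A p + B y}
  · left
    obtain ⟨b, hb1, hb2⟩ := exists_mem_interior_convexHull_affineBasis (mem_interior_iff_mem_nhds.1 h0)
    have hb3 : ∀ j, ∃ p ∈ S, ∃ y ∈ Submodule.span NNReal (φ '' G), b j = w0 + A p + B y :=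
      fun j => hb2 (subset_convexHull ℝ _ (mem_range_self j))
    choose p hp y hy hbj using hb3
    choose t ht hty using fun j => Submodule.mem_span_finite_of_mem_span (hy j)
    set t' := Finset.univ.biUnion t with ht'
    have hsub : ∀ y : t', ∃ u ∈ G, φ u = y := by
      rintro ⟨y, hy⟩
      obtain ⟨j, -, hj⟩ := Finset.mem_biUnion.1 hy
      exact ht j hj
    choose u huG hu using hsub
    let ub : Fin t'.card → Z := fun i => u (t'.equivFin.symm i)
    have hspan : Submodule.span NNReal (t' : Set Y)
        ≤ Submodule.span NNReal (range fun i => φ (ub i)) := by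
      apply Submodule.span_mono
      intro y hy
      refine ⟨t'.equivFin ⟨y, hy⟩, ?_⟩
      simp [ub, hu]
    refine ⟨t'.card, ub, fun i => huG _, ?_⟩
    refine interior_mono ?_ hb1
    have hsub2 : convexHull ℝ (range b) ⊆ {z | ∃ p ∈ S,
        ∃ y ∈ Submodule.span NNReal (range fun i => φ (ub i)), z = w0 + A p + B y} := by
      apply convexHull_min _ (hconv _)
      rintro _ ⟨j, rfl⟩
      refine ⟨p j, hp j, y j, hspan (Submodule.span_mono ?_ (hty j)), hbj j⟩
      intro y hy
      exact Finset.mem_coe.2 (Finset.mem_biUnion.2 ⟨j, Finset.mem_univ _, hy⟩)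
    refine hsub2.trans ?_
    rintro z ⟨p, hp, y, hy, rfl⟩
    obtain ⟨c, rfl⟩ := (Submodule.mem_span_range_iff_exists_fun NNReal).1 hy
    exact ⟨p, hp, fun i => c i, fun i => (c i).2, rfl⟩
  · right
    obtain ⟨p, hp⟩ := hSne
    obtain ⟨L, hL, h⟩ := sep_zero _ (hconv _) h0 ⟨_, p, hp, 0, Submodule.zero_mem _, rfl⟩
    exact ⟨L, hL, fun p hp y hy => h _ ⟨p, hp, y, hy, rfl⟩⟩

section
variable {X Y Z : Type*}
    [NormedAddCommGroup X] [NormedSpace ℝ X]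
    [NormedAddCommGroup Y] [NormedSpace ℝ Y]
    [NormedAddCommGroup Z] [NormedSpace ℝ Z]
    {n m₁ m₂ : ℕ}

lemma phi_first
    (F : (Fin n → ℝ) × X × Z → Y)
    (f : (Fin n → ℝ) × X → Fin m₁ → ℝ)
    (g : (Fin n → ℝ) × X → Fin m₂ → ℝ)
    (ξ0 : Fin n → ℝ) (x0 : X) (u0 : Z)
    (hF0 : F (ξ0, x0, u0) = 0)
    (hFsm : DifferentiableAt ℝ F (ξ0, x0, u0))
    (hfsm : DifferentiableAt ℝ f (ξ0, x0))
    (hgsm : DifferentiableAt ℝ g (ξ0, x0))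
    (e : X ≃L[ℝ] Y) (he : ∀ h : X, e h = fderiv ℝ F (ξ0, x0, u0) (0, h, 0))
    (k : ℕ) (ub : Fin k → Z) (hub : ∀ i, DifferentiableAt ℝ F (ξ0, x0, ub i))
    (χ : (Fin n → ℝ) × (Fin k → ℝ) × Z → X)
    (hχ0 : χ (ξ0, 0, u0) = x0)
    (hχ : DifferentiableAt ℝ χ (ξ0, 0, u0))
    (hχF : ∀ᶠ p : (Fin n → ℝ) × (Fin k → ℝ) × Z in nhds (ξ0, 0, u0),
          F (p.1, χ p, p.2.2)
            + ∑ i : Fin k, p.2.1 i • (F (p.1, χ p, ub i) - F (p.1, χ p, p.2.2)) = 0)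
    (ξ' : Fin n → ℝ) (aa : Fin k → ℝ) (r : Fin m₁ → ℝ) :
    fderiv ℝ
      (fun p : (Fin n → ℝ) × (Fin k → ℝ) × (Fin m₁ → ℝ) × Z =>
        ((f (p.1, χ (p.1, p.2.1, p.2.2.2)) + p.2.2.1,
          g (p.1, χ (p.1, p.2.1, p.2.2.2))) : (Fin m₁ → ℝ) × (Fin m₂ → ℝ)))
      (ξ0, 0, 0, u0) (ξ', aa, r, 0) =
    (fderiv ℝ f (ξ0, x0) (ξ', -e.symm (fderiv ℝ F (ξ0, x0, u0) (ξ', 0, 0)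
        + ∑ i, aa i • F (ξ0, x0, ub i))) + r,
     fderiv ℝ g (ξ0, x0) (ξ', -e.symm (fderiv ℝ F (ξ0, x0, u0) (ξ', 0, 0)
        + ∑ i, aa i • F (ξ0, x0, ub i)))) := by
  subst hχ0
  set x0 := χ (ξ0, 0, u0) with hx0
  -- line curves
  have hl : HasDerivAt (fun t : ℝ => ((ξ0, 0, u0) : (Fin n → ℝ) × (Fin k → ℝ) × Z)
      + t • (ξ', aa, (0:Z))) (ξ', aa, 0) 0 := by
    simpa using ((hasDerivAt_id (0:ℝ)).smul_const (ξ', aa, (0:Z))).const_add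
      ((ξ0, 0, u0) : (Fin n → ℝ) × (Fin k → ℝ) × Z)
  obtain ⟨d, hd⟩ : ∃ d, d = fderiv ℝ χ (ξ0, 0, u0) (ξ', aa, 0) := ⟨_, rfl⟩
  have hc : HasDerivAt (fun t : ℝ => χ (ξ0 + t • ξ', t • aa, u0)) d 0 := by
    have h1 : HasFDerivAt χ (fderiv ℝ χ (ξ0, 0, u0))
        ((ξ0, 0, u0) + (0:ℝ) • (ξ', aa, (0:Z))) := by simpa using hχ.hasFDerivAt
    have := h1.comp_hasDerivAt 0 hl
    rw [hd]
    convert this using 1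
    funext t; simp
  have hξ : HasDerivAt (fun t : ℝ => ξ0 + t • ξ') ξ' 0 := by
    simpa using ((hasDerivAt_id (0:ℝ)).smul_const ξ').const_add ξ0
  have hFu : ∀ u, DifferentiableAt ℝ F (ξ0, x0, u) →
      HasDerivAt (fun t : ℝ => F (ξ0 + t • ξ', χ (ξ0 + t • ξ', t • aa, u0), u))
        (fderiv ℝ F (ξ0, x0, u) (ξ', d, 0)) 0 := by
    intro u hu
    have hu' : HasFDerivAt F (fderiv ℝ F (ξ0, x0, u))
        (ξ0 + (0:ℝ) • ξ', χ (ξ0 + (0:ℝ) • ξ', (0:ℝ) • aa, u0), u) := by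
      simpa using hu.hasFDerivAt
    exact hu'.comp_hasDerivAt (0:ℝ) (hξ.prodMk (hc.prodMk (hasDerivAt_const (0:ℝ) u)))
  have hsum : HasDerivAt (fun t : ℝ => F (ξ0 + t • ξ', χ (ξ0 + t • ξ', t • aa, u0), u0)
      + ∑ i, (t * aa i) • (F (ξ0 + t • ξ', χ (ξ0 + t • ξ', t • aa, u0), ub i)
        - F (ξ0 + t • ξ', χ (ξ0 + t • ξ', t • aa, u0), u0)))
      (fderiv ℝ F (ξ0, x0, u0) (ξ', d, 0) + ∑ i, aa i • F (ξ0, x0, ub i)) 0 := by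
    refine (hFu u0 hFsm).add (HasDerivAt.fun_sum fun i _ => ?_)
    have := ((hasDerivAt_id (0:ℝ)).mul_const (aa i)).smul
      ((hFu (ub i) (hub i)).sub (hFu u0 hFsm))
    refine HasDerivAt.congr_deriv this ?_
    simp [← hx0, hF0]
  have hzero : (fun t : ℝ => F (ξ0 + t • ξ', χ (ξ0 + t • ξ', t • aa, u0), u0)
      + ∑ i, (t * aa i) • (F (ξ0 + t • ξ', χ (ξ0 + t • ξ', t • aa, u0), ub i)
        - F (ξ0 + t • ξ', χ (ξ0 + t • ξ', t • aa, u0), u0))) =ᶠ[𝓝 0] fun _ => 0 := by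
    have ht : Tendsto (fun t : ℝ => ((ξ0, 0, u0) : (Fin n → ℝ) × (Fin k → ℝ) × Z)
      + t • (ξ', aa, (0:Z))) (𝓝 0) (𝓝 (ξ0, 0, u0)) := by
      simpa using hl.continuousAt.tendsto
    filter_upwards [ht.eventually hχF] with t h
    simpa using h
  have h1 : fderiv ℝ F (ξ0, x0, u0) (ξ', d, 0) + ∑ i, aa i • F (ξ0, x0, ub i) = 0 :=
    hsum.unique ((hasDerivAt_const (0:ℝ) (0:Y)).congr_of_eventuallyEq hzero)
  have hdd : d = -e.symm (fderiv ℝ F (ξ0, x0, u0) (ξ', 0, 0) + ∑ i, aa i • F (ξ0, x0, ub i)) := by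
    rw [eq_neg_iff_add_eq_zero]
    apply e.injective
    rw [map_add, e.apply_symm_apply, map_zero, he, ← h1, ← add_assoc, ← map_add]
    simp
  rw [← hdd]
  have hΦd : DifferentiableAt ℝ (fun p : (Fin n → ℝ) × (Fin k → ℝ) × (Fin m₁ → ℝ) × Z =>
        ((f (p.1, χ (p.1, p.2.1, p.2.2.2)) + p.2.2.1,
          g (p.1, χ (p.1, p.2.1, p.2.2.2))) : (Fin m₁ → ℝ) × (Fin m₂ → ℝ))) (ξ0, 0, 0, u0) := by
    have hχ' : DifferentiableAt ℝ (fun p : (Fin n → ℝ) × (Fin k → ℝ) × (Fin m₁ → ℝ) × Z =>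
        (p.1, χ (p.1, p.2.1, p.2.2.2))) (ξ0, 0, 0, u0) := by
      refine differentiableAt_fst.prodMk ?_
      exact DifferentiableAt.comp (g := χ) (f := fun p : (Fin n → ℝ) × (Fin k → ℝ) × (Fin m₁ → ℝ) × Z => (p.1, p.2.1, p.2.2.2)) (ξ0, 0, 0, u0) hχ (by fun_prop)
    refine DifferentiableAt.prodMk (DifferentiableAt.add ?_ (by fun_prop)) ?_
    · exact DifferentiableAt.comp (g := f) (f := fun p : (Fin n → ℝ) × (Fin k → ℝ) × (Fin m₁ → ℝ) × Z => (p.1, χ (p.1, p.2.1, p.2.2.2))) (ξ0, 0, 0, u0) hfsm hχ'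
    · exact DifferentiableAt.comp (g := g) (f := fun p : (Fin n → ℝ) × (Fin k → ℝ) × (Fin m₁ → ℝ) × Z => (p.1, χ (p.1, p.2.1, p.2.2.2))) (ξ0, 0, 0, u0) hgsm hχ'
  have hL2 : HasDerivAt (fun t : ℝ => ((ξ0, 0, 0, u0) :
      (Fin n → ℝ) × (Fin k → ℝ) × (Fin m₁ → ℝ) × Z) + t • (ξ', aa, r, (0:Z))) (ξ', aa, r, 0) 0 := by
    simpa using ((hasDerivAt_id (0:ℝ)).smul_const (ξ', aa, r, (0:Z))).const_add
      ((ξ0, 0, 0, u0) : (Fin n → ℝ) × (Fin k → ℝ) × (Fin m₁ → ℝ) × Z)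
  have hA := (hΦd.hasFDerivAt).comp_hasDerivAt_of_eq (0:ℝ) hL2 (by simp)
  have hp := hξ.prodMk hc
  have hfd := hfsm.hasFDerivAt.comp_hasDerivAt_of_eq (0:ℝ) hp (by simp [hx0])
  have hgd := hgsm.hasFDerivAt.comp_hasDerivAt_of_eq (0:ℝ) hp (by simp [hx0])
  have hr : HasDerivAt (fun t : ℝ => t • r) r 0 := by
    simpa using (hasDerivAt_id (0:ℝ)).smul_const r
  have hB := (hfd.add hr).prodMk hgd
  refine hA.unique (hB.congr_of_eventuallyEq (Eventually.of_forall fun t => ?_))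
  simp

lemma phi_second
    (F : (Fin n → ℝ) × X × Z → Y)
    (f : (Fin n → ℝ) × X → Fin m₁ → ℝ)
    (g : (Fin n → ℝ) × X → Fin m₂ → ℝ)
    (ξ0 : Fin n → ℝ) (x0 : X) (u0 : Z)
    (hFsm : ContDiffAt ℝ 2 F (ξ0, x0, u0))
    (hfsm : ContDiffAt ℝ 2 f (ξ0, x0))
    (hgsm : ContDiffAt ℝ 2 g (ξ0, x0))
    (e : X ≃L[ℝ] Y) (he : ∀ h : X, e h = fderiv ℝ F (ξ0, x0, u0) (0, h, 0))
    (k : ℕ) (ub : Fin k → Z)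
    (q : (Fin n → ℝ) × X × Z)
    (hq1 : fderiv ℝ F (ξ0, x0, u0) q = 0)
    (χ : (Fin n → ℝ) × (Fin k → ℝ) × Z → X)
    (hχ0 : χ (ξ0, 0, u0) = x0)
    (hχ : ContDiffAt ℝ 2 χ (ξ0, 0, u0))
    (hχF : ∀ᶠ p : (Fin n → ℝ) × (Fin k → ℝ) × Z in nhds (ξ0, 0, u0),
          F (p.1, χ p, p.2.2)
            + ∑ i : Fin k, p.2.1 i • (F (p.1, χ p, ub i) - F (p.1, χ p, p.2.2)) = 0) :
    fderiv ℝ (fderiv ℝ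
      (fun p : (Fin n → ℝ) × (Fin k → ℝ) × (Fin m₁ → ℝ) × Z =>
        ((f (p.1, χ (p.1, p.2.1, p.2.2.2)) + p.2.2.1,
          g (p.1, χ (p.1, p.2.1, p.2.2.2))) : (Fin m₁ → ℝ) × (Fin m₂ → ℝ))))
      (ξ0, 0, 0, u0) (q.1, 0, 0, q.2.2) (q.1, 0, 0, q.2.2) =
    (fderiv ℝ (fderiv ℝ f) (ξ0, x0) (q.1, q.2.1) (q.1, q.2.1)
      + fderiv ℝ f (ξ0, x0) (0, -e.symm (fderiv ℝ (fderiv ℝ F) (ξ0, x0, u0) q q)),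
     fderiv ℝ (fderiv ℝ g) (ξ0, x0) (q.1, q.2.1) (q.1, q.2.1)
      + fderiv ℝ g (ξ0, x0) (0, -e.symm (fderiv ℝ (fderiv ℝ F) (ξ0, x0, u0) q q))) := by
  obtain ⟨ζ, h, v⟩ := q
  simp only
  set c : ℝ → X := fun t => χ (ξ0 + t • ζ, 0, u0 + t • v) with hc
  have hc0 : c 0 = x0 := by simp [hc, hχ0]
  have hlζ : ContDiffAt ℝ 2 (fun t : ℝ => ξ0 + t • ζ) 0 := by fun_prop
  have hlv : ContDiffAt ℝ 2 (fun t : ℝ => u0 + t • v) 0 := by fun_prop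
  have hin : ContDiffAt ℝ 2 (fun t : ℝ => ((ξ0 + t • ζ, 0, u0 + t • v) :
      (Fin n → ℝ) × (Fin k → ℝ) × Z)) 0 := by fun_prop
  have hcs : ContDiffAt ℝ 2 c 0 :=
    ContDiffAt.comp (g := χ) (0:ℝ) (by simpa using hχ) hin
  -- F curve
  have hcv := deriv_prod2 c (fun t => u0 + t • v) hcs hlv
  have hγF := deriv_prod2 (fun t => ξ0 + t • ζ) (fun t => (c t, u0 + t • v)) hlζ (hcs.prodMk hlv)
  have hγf := deriv_prod2 (fun t => ξ0 + t • ζ) c hlζ hcs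
  have hF2 := second_deriv_curve F (fun t => (ξ0 + t • ζ, c t, u0 + t • v)) (ξ0, x0, u0)
    (by simp [hc0]) hFsm (hlζ.prodMk (hcs.prodMk hlv))
  have hf2 := second_deriv_curve f (fun t => (ξ0 + t • ζ, c t)) (ξ0, x0)
    (by simp [hc0]) hfsm (hlζ.prodMk hcs)
  have hg2 := second_deriv_curve g (fun t => (ξ0 + t • ζ, c t)) (ξ0, x0)
    (by simp [hc0]) hgsm (hlζ.prodMk hcs)
  rw [hγF.1, hγF.2, hcv.1, hcv.2] at hF2
  rw [hγf.1, hγf.2] at hf2 hg2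
  simp only [deriv_line, deriv_const'] at hF2 hf2 hg2
  have hz : (fun t : ℝ => F (ξ0 + t • ζ, c t, u0 + t • v)) =ᶠ[𝓝 0] fun _ => 0 := by
    have ht : Tendsto (fun t : ℝ => ((ξ0 + t • ζ, 0, u0 + t • v) :
      (Fin n → ℝ) × (Fin k → ℝ) × Z)) (𝓝 0) (𝓝 (ξ0, 0, u0)) := by
      simpa using hin.continuousAt.tendsto
    filter_upwards [ht.eventually hχF] with t h
    simpa using h
  have hz1 : deriv (fun t : ℝ => F (ξ0 + t • ζ, c t, u0 + t • v)) 0 = 0 := by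
    rw [hz.deriv_eq]; simp
  have hz2 : deriv (deriv (fun t : ℝ => F (ξ0 + t • ζ, c t, u0 + t • v))) 0 = 0 := by
    rw [hz.deriv.deriv_eq]; simp
  have hch : deriv c 0 = h := by
    have h1 := hF2.1.symm.trans hz1
    rw [← sub_eq_zero]
    apply e.injective
    rw [he, map_zero, ← sub_zero (0:Y)]
    nth_rewrite 1 [← h1]
    rw [← hq1, ← map_sub]
    simp
  rw [hch] at hF2 hf2 hg2
  have hcc : deriv (deriv c) 0 = -e.symm (fderiv ℝ (fderiv ℝ F) (ξ0, x0, u0) (ζ, h, v) (ζ, h, v)) := by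
    have h1 := hF2.2.symm.trans hz2
    rw [eq_neg_iff_add_eq_zero]
    apply e.injective
    rw [map_add, e.apply_symm_apply, map_zero, he, add_comm, h1]
  rw [hcc] at hf2 hg2
  have hΦs : ContDiffAt ℝ 2 (fun p : (Fin n → ℝ) × (Fin k → ℝ) × (Fin m₁ → ℝ) × Z =>
        ((f (p.1, χ (p.1, p.2.1, p.2.2.2)) + p.2.2.1,
          g (p.1, χ (p.1, p.2.1, p.2.2.2))) : (Fin m₁ → ℝ) × (Fin m₂ → ℝ))) (ξ0, 0, 0, u0) := by
    have hχ' : ContDiffAt ℝ 2 (fun p : (Fin n → ℝ) × (Fin k → ℝ) × (Fin m₁ → ℝ) × Z =>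
        (p.1, χ (p.1, p.2.1, p.2.2.2))) (ξ0, 0, 0, u0) := by
      refine contDiffAt_fst.prodMk ?_
      exact ContDiffAt.comp (g := χ) (f := fun p : (Fin n → ℝ) × (Fin k → ℝ) × (Fin m₁ → ℝ) × Z => (p.1, p.2.1, p.2.2.2)) (ξ0, 0, 0, u0) hχ (by fun_prop)
    refine ContDiffAt.prodMk (ContDiffAt.add ?_ (by fun_prop)) ?_
    · exact ContDiffAt.comp (g := f) (f := fun p : (Fin n → ℝ) × (Fin k → ℝ) × (Fin m₁ → ℝ) × Z => (p.1, χ (p.1, p.2.1, p.2.2.2))) (ξ0, 0, 0, u0) (by simpa [hχ0] using hfsm) hχ'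
    · exact ContDiffAt.comp (g := g) (f := fun p : (Fin n → ℝ) × (Fin k → ℝ) × (Fin m₁ → ℝ) × Z => (p.1, χ (p.1, p.2.1, p.2.2.2))) (ξ0, 0, 0, u0) (by simpa [hχ0] using hgsm) hχ'
  have hΦ2 := (second_deriv_curve _ (fun t : ℝ => ((ξ0, 0, 0, u0) :
      (Fin n → ℝ) × (Fin k → ℝ) × (Fin m₁ → ℝ) × Z) + t • (ζ, 0, 0, v)) _ (by simp) hΦs
      (by fun_prop)).2
  simp only [deriv_line, deriv_const', map_zero, add_zero] at hΦ2
  rw [← hΦ2]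
  have hfc : ContDiffAt ℝ 2 (fun t => f (ξ0 + t • ζ, c t)) 0 :=
    ContDiffAt.comp (g := f) (0:ℝ) (by simpa [hc0] using hfsm) (hlζ.prodMk hcs)
  have hgc : ContDiffAt ℝ 2 (fun t => g (ξ0 + t • ζ, c t)) 0 :=
    ContDiffAt.comp (g := g) (0:ℝ) (by simpa [hc0] using hgsm) (hlζ.prodMk hcs)
  have hfg := (deriv_prod2 _ _ hfc hgc).2
  rw [hf2.2, hg2.2] at hfg
  rw [← hfg]
  simp [hc]
end

/-- **Proposition 1.**  Under the hypotheses of Theorem 1 there exist `k ∈ ℕ` and a tuple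
`ub = (û₁,…,û_k) ∈ 𝒰^k` such that, for (any) local implicit solution `χ` of
`ℱ(ξ,x,ᾱ,u;ub) = 0` near `(ξ0,0,u0)` with `χ(ξ0,0,u0) = x0`, the mapping
`Φ(ξ,ᾱ,r,u) = (f(ξ,χ(ξ,ᾱ,u)) + r, g(ξ,χ(ξ,ᾱ,u)))` satisfies
`0 ∈ int { Φ_{(ξ,ᾱ,r)}(ξ0,0,0,u0)(ℝⁿ × ℝᵏ₊ × (ℝ^{m₁}₊ + f(ξ0,x0)))
           + conv Φ_{ww}(ξ0,0,0,u0)[(ζ,v),(ζ,v)] }`, where `w = (ξ,u)`. -/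
theorem abstract_system_interior_condition
    {X Y Z : Type*}
    [NormedAddCommGroup X] [NormedSpace ℝ X] [CompleteSpace X]
    [NormedAddCommGroup Y] [NormedSpace ℝ Y] [CompleteSpace Y]
    [NormedAddCommGroup Z] [NormedSpace ℝ Z] [CompleteSpace Z]
    {n m₁ m₂ : ℕ}
    (𝒰 : Set Z)
    (F : (Fin n → ℝ) × X × Z → Y)
    (f : (Fin n → ℝ) × X → Fin m₁ → ℝ)
    (g : (Fin n → ℝ) × X → Fin m₂ → ℝ)
    (ξ0 : Fin n → ℝ) (x0 : X) (u0 : Z)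
    -- admissibility of the point (ξ0, x0, u0)
    (hF0 : F (ξ0, x0, u0) = 0)
    (hu0 : u0 ∈ interior 𝒰)
    (hf0 : ∀ i, f (ξ0, x0) i ≤ 0)
    (hg0 : g (ξ0, x0) = 0)
    -- Basic Assumption 2: smoothness and invertibility of F_x
    (hFsm : ContDiffAt ℝ 2 F (ξ0, x0, u0))
    (hfsm : ContDiffAt ℝ 2 f (ξ0, x0))
    (hgsm : ContDiffAt ℝ 2 g (ξ0, x0))
    (hFxinv : ∃ e : X ≃L[ℝ] Y, ∀ h : X, e h = fderiv ℝ F (ξ0, x0, u0) (0, h, 0))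
    -- Basic Assumption 3: mix of controls
    (hmix : ∀ (k : ℕ) (ε : ℝ), 0 < ε →
      ∃ M : (Fin k → ℝ) → (Fin (k + 1) → Z) → Z,
        (∀ ub : Fin (k + 1) → Z, (∀ i, ub i ∈ 𝒰) →
          ContinuousOn (fun aa => M aa ub) {aa : Fin k → ℝ | (∀ i, 0 ≤ aa i) ∧ ∑ i, aa i < 1} ∧
          ∀ aa : Fin k → ℝ, (∀ i, 0 ≤ aa i) → ∑ i, aa i < 1 → M aa ub ∈ 𝒰) ∧
        (∀ (ξ' : Fin n → ℝ) (x' : X) (ub : Fin (k + 1) → Z), (∀ i, ub i ∈ 𝒰) →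
          ∃ U ∈ nhds ((ξ', x', ub) : (Fin n → ℝ) × X × (Fin (k + 1) → Z)),
            ∀ p ∈ U, ∀ aa : Fin k → ℝ, (∀ i, 0 ≤ aa i) → ∑ i, aa i < 1 →
              ‖F (p.1, p.2.1, M aa p.2.2)
                  - ((1 - ∑ i, aa i) • F (p.1, p.2.1, p.2.2 0)
                    + ∑ i : Fin k, aa i • F (p.1, p.2.1, p.2.2 i.succ))‖ < ε ∧
              ‖(fderiv ℝ F (p.1, p.2.1, M aa p.2.2)).comp (embX n X Z)
                  - ((1 - ∑ i, aa i) • (fderiv ℝ F (p.1, p.2.1, p.2.2 0)).comp (embX n X Z)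
                    + ∑ i : Fin k, aa i •
                        (fderiv ℝ F (p.1, p.2.1, p.2.2 i.succ)).comp (embX n X Z))‖ < ε))
    -- q = (ζ, h, v) ∈ K(ξ0, x0, u0)
    (q : (Fin n → ℝ) × X × Z)
    (hq1 : fderiv ℝ F (ξ0, x0, u0) q = 0)
    (hq2 : ∀ i, fderiv ℝ f (ξ0, x0) (q.1, q.2.1) i ≤ 0)
    (hq3 : fderiv ℝ g (ξ0, x0) (q.1, q.2.1) = 0)
    -- Λ(ξ0, x0, u0, q) = ∅
    (hΛ : ¬ ∃ (y' : Y →L[ℝ] ℝ) (l₁ : Fin m₁ → ℝ) (l₂ : Fin m₂ → ℝ),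
      (∀ i, 0 ≤ l₁ i) ∧ (l₁ ≠ 0 ∨ l₂ ≠ 0) ∧
      (∀ ζ : Fin n → ℝ,
        y' (fderiv ℝ F (ξ0, x0, u0) (ζ, 0, 0)) + l₁ ⬝ᵥ fderiv ℝ f (ξ0, x0) (ζ, 0)
          + l₂ ⬝ᵥ fderiv ℝ g (ξ0, x0) (ζ, 0) = 0) ∧
      (∀ h : X,
        y' (fderiv ℝ F (ξ0, x0, u0) (0, h, 0)) + l₁ ⬝ᵥ fderiv ℝ f (ξ0, x0) (0, h)
          + l₂ ⬝ᵥ fderiv ℝ g (ξ0, x0) (0, h) = 0) ∧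
      (∀ u ∈ 𝒰, y' (F (ξ0, x0, u0)) ≤ y' (F (ξ0, x0, u))) ∧
      y' (F (ξ0, x0, u0)) = 0 ∧
      l₁ ⬝ᵥ f (ξ0, x0) = 0 ∧
      0 ≤ y' (fderiv ℝ (fderiv ℝ F) (ξ0, x0, u0) q q)
          + l₁ ⬝ᵥ fderiv ℝ (fderiv ℝ f) (ξ0, x0) (q.1, q.2.1) (q.1, q.2.1)
          + l₂ ⬝ᵥ fderiv ℝ (fderiv ℝ g) (ξ0, x0) (q.1, q.2.1) (q.1, q.2.1)) :
    -- conclusion: Proposition 1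
    ∃ (k : ℕ) (ub : Fin k → Z), (∀ i, ub i ∈ 𝒰) ∧
      ∀ χ : (Fin n → ℝ) × (Fin k → ℝ) × Z → X,
        χ (ξ0, 0, u0) = x0 →
        ContDiffAt ℝ 2 χ (ξ0, 0, u0) →
        (∀ᶠ p : (Fin n → ℝ) × (Fin k → ℝ) × Z in nhds (ξ0, 0, u0),
          F (p.1, χ p, p.2.2)
            + ∑ i : Fin k, p.2.1 i • (F (p.1, χ p, ub i) - F (p.1, χ p, p.2.2)) = 0) →
        (0 : (Fin m₁ → ℝ) × (Fin m₂ → ℝ)) ∈ interior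
          {z : (Fin m₁ → ℝ) × (Fin m₂ → ℝ) |
            ∃ (ξ' : Fin n → ℝ) (aa : Fin k → ℝ) (s : Fin m₁ → ℝ) (β : ℝ),
              (∀ i, 0 ≤ aa i) ∧ (∀ i, 0 ≤ s i) ∧ 0 ≤ β ∧
              z = fderiv ℝ
                    (fun p : (Fin n → ℝ) × (Fin k → ℝ) × (Fin m₁ → ℝ) × Z =>
                      ((f (p.1, χ (p.1, p.2.1, p.2.2.2)) + p.2.2.1,
                        g (p.1, χ (p.1, p.2.1, p.2.2.2))) : (Fin m₁ → ℝ) × (Fin m₂ → ℝ)))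
                    (ξ0, 0, 0, u0) (ξ', aa, s + f (ξ0, x0), 0)
                  + β • (fderiv ℝ (fderiv ℝ
                      (fun p : (Fin n → ℝ) × (Fin k → ℝ) × (Fin m₁ → ℝ) × Z =>
                        ((f (p.1, χ (p.1, p.2.1, p.2.2.2)) + p.2.2.1,
                          g (p.1, χ (p.1, p.2.1, p.2.2.2))) : (Fin m₁ → ℝ) × (Fin m₂ → ℝ))))
                      (ξ0, 0, 0, u0) (q.1, 0, 0, q.2.2) (q.1, 0, 0, q.2.2))} := by
  classical
  obtain ⟨e, he⟩ := hFxinv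
  set f' := fderiv ℝ f (ξ0, x0) with hf'
  set g' := fderiv ℝ g (ξ0, x0) with hg'
  set F' := fderiv ℝ F (ξ0, x0, u0) with hF'
  set b := fderiv ℝ (fderiv ℝ F) (ξ0, x0, u0) q q with hb
  let Q : (Fin m₁ → ℝ) × (Fin m₂ → ℝ) :=
    (fderiv ℝ (fderiv ℝ f) (ξ0, x0) (q.1, q.2.1) (q.1, q.2.1) + f' (0, -e.symm b),
     fderiv ℝ (fderiv ℝ g) (ξ0, x0) (q.1, q.2.1) (q.1, q.2.1) + g' (0, -e.symm b))
  let G : Set Z := {u | u ∈ 𝒰 ∧ DifferentiableAt ℝ F (ξ0, x0, u)}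
  let R : (Fin n → ℝ) →L[ℝ] (Fin n → ℝ) × X :=
    (ContinuousLinearMap.id ℝ _).prod
      (-((e.symm : Y →L[ℝ] X).comp (F'.comp (ContinuousLinearMap.inl ℝ _ _))))
  let A : ((Fin n → ℝ) × (Fin m₁ → ℝ) × ℝ) →L[ℝ] (Fin m₁ → ℝ) × (Fin m₂ → ℝ) :=
    ((f'.comp R).prod (g'.comp R)).comp (ContinuousLinearMap.fst ℝ _ _)
    + (ContinuousLinearMap.inl ℝ _ _).comp
        ((ContinuousLinearMap.fst ℝ _ _).comp (ContinuousLinearMap.snd ℝ _ _))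
    + ((ContinuousLinearMap.snd ℝ _ _).comp (ContinuousLinearMap.snd ℝ _ _)).smulRight Q
  let B : Y →L[ℝ] (Fin m₁ → ℝ) × (Fin m₂ → ℝ) :=
    ((f'.comp (ContinuousLinearMap.inr ℝ _ _)).prod
      (g'.comp (ContinuousLinearMap.inr ℝ _ _))).comp (-(e.symm : Y →L[ℝ] X))
  have hR : ∀ ξ', R ξ' = (ξ', -e.symm (F' (ξ', 0, 0))) := fun ξ' => rfl
  have hA : ∀ p, A p = (f' (R p.1) + p.2.1, g' (R p.1)) + p.2.2 • Q := by
    intro p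
    ext i <;> simp [A]
  have hB : ∀ y, B y = (f' (0, -e.symm y), g' (0, -e.symm y)) := fun y => rfl
  let S : Set ((Fin n → ℝ) × (Fin m₁ → ℝ) × ℝ) := {p | (∀ i, 0 ≤ p.2.1 i) ∧ 0 ≤ p.2.2}
  have hS : Convex ℝ S := by
    rintro p ⟨hp1, hp2⟩ p' ⟨hp1', hp2'⟩ a c ha hc hac
    refine ⟨fun i => ?_, ?_⟩
    · have h1 := hp1 i
      have h2 := hp1' i
      simp only [Prod.snd_add, Prod.fst_add, Prod.smul_snd, Prod.smul_fst, Pi.add_apply,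
        Pi.smul_apply, smul_eq_mul]
      positivity
    · simp only [Prod.snd_add, Prod.smul_snd, smul_eq_mul]
      positivity
  rcases core_sep (fun u => F (ξ0, x0, u)) G S hS ⟨0, by simp [S]⟩
    ((f (ξ0, x0), 0) : (Fin m₁ → ℝ) × (Fin m₂ → ℝ))
    (A : _ →ₗ[ℝ] _) (B : _ →ₗ[ℝ] _) with ⟨k, ub, hub, hint⟩ | ⟨L, hL0, hL⟩
  · refine ⟨k, ub, fun i => (hub i).1, fun χ hχ0 hχ hχF => ?_⟩
    refine interior_mono ?_ hint
    rintro z ⟨⟨ξ', s, β⟩, ⟨hs, hβ⟩, aa, haa, rfl⟩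
    refine ⟨ξ', aa, s, β, haa, hs, hβ, ?_⟩
    rw [phi_second F f g ξ0 x0 u0 hFsm hfsm hgsm e he k ub q hq1 χ hχ0 hχ hχF,
      phi_first F f g ξ0 x0 u0 hF0 (hFsm.differentiableAt (by simp))
        (hfsm.differentiableAt (by simp)) (hgsm.differentiableAt (by simp)) e he k ub
        (fun i => (hub i).2) χ hχ0 (hχ.differentiableAt (by simp)) hχF]
    change _ = _ + β • Q
    simp only [ContinuousLinearMap.coe_coe]
    rw [hA, hB, hR]
    generalize (∑ i, aa i • F (ξ0, x0, ub i)) = y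
    have hsplit : ((ξ', -e.symm (F' (ξ', 0, 0) + y)) : (Fin n → ℝ) × X)
        = (ξ', -e.symm (F' (ξ', 0, 0))) + (0, -e.symm y) := by
      rw [Prod.mk_add_mk, map_add, neg_add, add_zero]
    rw [← hf', ← hg', ← hF', hsplit, map_add, map_add]
    ext i
    · simp; ring
    · simp; ring
  · exfalso
    -- coordinates of the functional
    let l₁ : Fin m₁ → ℝ := fun i => L (Pi.single i 1, 0)
    let l₂ : Fin m₂ → ℝ := fun i => L (0, Pi.single i 1)
    have hLl : ∀ a c, L (a, c) = l₁ ⬝ᵥ a + l₂ ⬝ᵥ c := by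
      intro a c
      have h1 : ((a, c) : (Fin m₁ → ℝ) × (Fin m₂ → ℝ))
          = ∑ i, a i • ((Pi.single i 1 : Fin m₁ → ℝ), (0 : Fin m₂ → ℝ))
            + ∑ i, c i • ((0 : Fin m₁ → ℝ), (Pi.single i 1 : Fin m₂ → ℝ)) := by
        ext j <;> simp [Prod.fst_sum, Prod.snd_sum, Finset.sum_apply, Pi.single_apply]
      rw [h1, map_add, map_sum, map_sum]
      simp only [map_smul, smul_eq_mul, dotProduct, l₁, l₂, mul_comm]
    have hw : ∀ ξ' s β, (∀ i, 0 ≤ s i) → 0 ≤ β → ∀ y ∈ Submodule.span NNReal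
        ((fun u => F (ξ0, x0, u)) '' G),
        0 ≤ L (f (ξ0, x0), 0) + L (A (ξ', s, β)) + L (B y) := by
      intro ξ' s β hs hβ y hy
      simpa using hL (ξ', s, β) ⟨hs, hβ⟩ y hy
    set c0 := L (f (ξ0, x0), 0) with hc0
    have hscale : ∀ a : ℝ, (∀ t : ℝ, 0 ≤ t → 0 ≤ c0 + t * a) → 0 ≤ a := by
      intro a h
      by_contra hneg
      push Not at hneg
      have h1 := h ((|c0| + 1) / (-a)) (by apply div_nonneg <;> linarith [abs_nonneg c0])
      have h2 : (|c0| + 1) / (-a) * a = -(|c0| + 1) := by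
        have hne : a ≠ 0 := hneg.ne
        rw [div_neg, neg_mul, div_mul_cancel₀ _ hne]
      rw [h2] at h1
      linarith [le_abs_self c0]
    have hc0' : 0 ≤ c0 := by
      have := hw 0 0 0 (by simp) le_rfl 0 (Submodule.zero_mem _)
      have hz : ((0, 0, 0) : (Fin n → ℝ) × (Fin m₁ → ℝ) × ℝ) = 0 := rfl
      simpa [hz] using this
    have hscaleP : ∀ p ∈ S, 0 ≤ L (A p) := by
      rintro ⟨ξ', s, β⟩ ⟨hs, hβ⟩
      refine hscale _ fun t ht => ?_
      have := hw (t • ξ') (t • s) (t • β) (fun i => mul_nonneg ht (hs i)) (mul_nonneg ht hβ) 0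
        (Submodule.zero_mem _)
      have h2 : ((t • ξ', t • s, t • β) : (Fin n → ℝ) × (Fin m₁ → ℝ) × ℝ) = t • (ξ', s, β) := rfl
      rw [h2, map_smul, map_smul, smul_eq_mul, map_zero, map_zero, add_zero] at this
      exact this
    have hl₁ : ∀ i, 0 ≤ l₁ i := by
      intro i
      have := hscaleP (0, Pi.single i 1, 0) ⟨fun j => by
        by_cases h : j = i <;> simp [Pi.single_apply, h], le_rfl⟩
      rw [hA] at this
      simpa [l₁] using this
    have hξ : ∀ ξ', l₁ ⬝ᵥ f' (R ξ') + l₂ ⬝ᵥ g' (R ξ') = 0 := by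
      intro ξ'
      have h1 : ∀ ξ', 0 ≤ l₁ ⬝ᵥ f' (R ξ') + l₂ ⬝ᵥ g' (R ξ') := by
        intro ξ'
        have := hscaleP (ξ', 0, 0) ⟨by simp, le_rfl⟩
        rw [hA] at this
        simpa [hLl] using this
      have h2 := h1 (-ξ')
      simp only [map_neg, dotProduct_neg] at h2
      linarith [h1 ξ']
    have hQ : 0 ≤ L Q := by
      have := hscaleP (0, 0, 1) ⟨by simp, by simp⟩
      rw [hA] at this
      have hz : (((0 : Fin m₁ → ℝ), (0 : Fin m₂ → ℝ))) = 0 := rfl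
      simpa [hz] using this
    let y' : Y →L[ℝ] ℝ := (LinearMap.toContinuousLinearMap L).comp B
    have hy' : ∀ y, y' y = l₁ ⬝ᵥ f' (0, -e.symm y) + l₂ ⬝ᵥ g' (0, -e.symm y) := by
      intro y
      have : y' y = L (B y) := rfl
      rw [this, hB, hLl]
    have hgood : ∀ u ∈ G, 0 ≤ y' (F (ξ0, x0, u)) := by
      intro u hu
      refine hscale _ fun t ht => ?_
      have := hw 0 0 0 (by simp) le_rfl (t • F (ξ0, x0, u))
        (Submodule.smul_mem _ (⟨t, ht⟩ : NNReal) (Submodule.subset_span ⟨u, hu, rfl⟩))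
      have hz : ((0, 0, 0) : (Fin n → ℝ) × (Fin m₁ → ℝ) × ℝ) = 0 := rfl
      rw [hz, map_zero, map_zero, add_zero, map_smul, map_smul, smul_eq_mul] at this
      exact this
    have hall : ∀ u ∈ 𝒰, 0 ≤ y' (F (ξ0, x0, u)) := by
      intro u hu
      by_cases hdiff : DifferentiableAt ℝ F (ξ0, x0, u)
      · exact hgood u ⟨hu, hdiff⟩
      by_contra hneg
      push Not at hneg
      set δ := -y' (F (ξ0, x0, u)) with hδ
      have hδpos : 0 < δ := by linarith
      have hN : 0 < ‖F'.comp (embX n X Z)‖ := by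
        rw [norm_pos_iff]
        intro h0
        apply hdiff
        have : Subsingleton Y := by
          refine subsingleton_of_forall_eq 0 fun y => ?_
          have h1 := he (e.symm y)
          rw [e.apply_symm_apply] at h1
          rw [h1]
          exact DFunLike.congr_fun h0 (e.symm y)
        have : F = fun _ => 0 := funext fun _ => Subsingleton.elim _ _
        rw [this]
        exact differentiableAt_const _
      set N := ‖F'.comp (embX n X Z)‖ with hNdef
      obtain ⟨M, hM1, hM2⟩ := hmix 1 (min (N / 2) (δ / (2 * (‖y'‖ + 1))))
        (lt_min (by positivity) (by positivity))
      have hub : ∀ i, (![u0, u] : Fin 2 → Z) i ∈ 𝒰 := by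
        intro i
        fin_cases i
        · exact interior_subset hu0
        · exact hu
      obtain ⟨U, hU, hMU⟩ := hM2 ξ0 x0 ![u0, u] hub
      have haa : ∑ i : Fin 1, (fun _ => 1 / 2 : Fin 1 → ℝ) i < 1 := by norm_num
      obtain ⟨h1, h2⟩ := hMU _ (mem_of_mem_nhds hU) (fun _ => 1 / 2) (by intro i; norm_num) haa
      have hMu := (hM1 ![u0, u] hub).2 (fun _ => 1 / 2) (by intro i; norm_num) haa
      set um := M (fun _ => 1 / 2) ![u0, u] with hum
      have hGum : um ∈ G := by
        refine ⟨hMu, ?_⟩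
        by_contra hnd
        have h3 := lt_of_lt_of_le h2 (min_le_left _ _)
        simp only [Fin.sum_univ_one, Matrix.cons_val_zero, Fin.succ_zero_eq_one,
          Matrix.cons_val_one] at h3
        rw [fderiv_zero_of_not_differentiableAt hnd,
          fderiv_zero_of_not_differentiableAt hdiff, ← hF', ContinuousLinearMap.zero_comp,
          smul_zero, add_zero, zero_sub, norm_neg, norm_smul, ← hNdef] at h3
        norm_num at h3
        linarith
      have h3 := lt_of_lt_of_le h1 (min_le_right _ _)
      simp only [Fin.sum_univ_one, Matrix.cons_val_zero, Fin.succ_zero_eq_one,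
          Matrix.cons_val_one, hF0, smul_zero, zero_add] at h3
      have h4 := hgood um hGum
      have h5 : y' (F (ξ0, x0, um)) = y' (F (ξ0, x0, um) - (1 / 2 : ℝ) • F (ξ0, x0, u))
          - δ / 2 := by
        rw [map_sub, map_smul, smul_eq_mul, hδ]; ring
      have h6 := (le_abs_self _).trans (y'.le_opNorm (F (ξ0, x0, um) - (1 / 2 : ℝ) • F (ξ0, x0, u)))
      have h7 : ‖y'‖ * ‖F (ξ0, x0, um) - (1 / 2 : ℝ) • F (ξ0, x0, u)‖
          ≤ ‖y'‖ * (δ / (2 * (‖y'‖ + 1))) := mul_le_mul_of_nonneg_left h3.le (norm_nonneg _)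
      have h8 : ‖y'‖ * (δ / (2 * (‖y'‖ + 1))) < δ / 2 := by
        have hy0 := norm_nonneg y'
        rw [← mul_div_assoc, div_lt_div_iff₀ (by positivity) (by norm_num)]
        nlinarith
      linarith
    refine hΛ ⟨y', l₁, l₂, hl₁, ?_, ?_, ?_, ?_, ?_, ?_, ?_⟩
    · by_contra hcon
      push Not at hcon
      apply hL0
      apply LinearMap.ext
      rintro ⟨a, c⟩
      rw [hLl, hcon.1, hcon.2]
      simp
    · intro ζ
      have := hξ ζ
      have hsp : R ζ = (ζ, 0) + (0, -e.symm (F' (ζ, 0, 0))) := by rw [hR]; simp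
      rw [hsp, map_add, map_add, dotProduct_add, dotProduct_add] at this
      rw [hy']
      linarith
    · intro h
      rw [hy', ← he, e.symm_apply_apply]
      have hsp : ((0, -h) : (Fin n → ℝ) × X) = -(0, h) := by simp
      rw [hsp, map_neg, map_neg, dotProduct_neg, dotProduct_neg]
      ring
    · intro u hu
      rw [hF0, map_zero]
      exact hall u hu
    · rw [hF0, map_zero]
    · have h1 : 0 ≤ l₁ ⬝ᵥ f (ξ0, x0) := by
        rw [hc0, hLl] at hc0'
        simpa using hc0'
      have h2 : l₁ ⬝ᵥ f (ξ0, x0) ≤ 0 :=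
        Finset.sum_nonpos fun i _ => mul_nonpos_of_nonneg_of_nonpos (hl₁ i) (hf0 i)
      linarith
    · simp only [Q] at hQ
      rw [hLl, dotProduct_add, dotProduct_add] at hQ
      rw [hy']
      linarith
end
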